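/- arXiv:2102.07829 — 5 statements merged into one kernel-verified Lean document; each statement's English description precedes it below -/
import Mathlib

section
/- (Lemma 2.2) Let (u,v,z) be a classical solution of the transmission system. Then for every t > 0 the total energy E satisfies E'(t) ≤ −μ₁(t) ( 1 − ξ̄/2 − β/(2√(1−d)) ) ∫_Ω u_t(x,t)² dx − μ₁(t) ( ξ̄(1−τ'(t))/2 − β√(1−d)/2 ) ∫_Ω z(x,1,t)² dx ≤ 0; in particular E is non-increasing. -/
open Set Real MeasureTheory intervalIntegral

noncomputable section

/-- The closed damped region `Ω̄ = [0,L₁] ∪ [L₂,L₃]`. -/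
def Omegac (L1 L2 L3 : ℝ) : Set ℝ := Set.Icc 0 L1 ∪ Set.Icc L2 L3

/-- The open damped region `Ω = (0,L₁) ∪ (L₂,L₃)`. -/
def Omegao (L1 L2 L3 : ℝ) : Set ℝ := Set.Ioo 0 L1 ∪ Set.Ioo L2 L3

/-- Data and standing hypotheses for the transmission problem for waves with
time-varying delay and nonlinear weights. -/
structure TransmissionSystem where
  L1 : ℝ
  L2 : ℝ
  L3 : ℝ
  a : ℝ
  b : ℝ
  τ0 : ℝ
  τ1 : ℝ
  d : ℝ
  M1 : ℝ
  M2 : ℝ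
  β : ℝ
  τ : ℝ → ℝ
  τ' : ℝ → ℝ
  μ1 : ℝ → ℝ
  μ1' : ℝ → ℝ
  μ2 : ℝ → ℝ
  μ2' : ℝ → ℝ
  hL1 : 0 < L1
  hL12 : L1 < L2
  hL23 : L2 < L3
  ha : 0 < a
  hb : 0 < b
  hτ0 : 0 < τ0
  hτderiv : ∀ t ∈ Set.Ici (0:ℝ), HasDerivAt τ (τ' t) t
  hτ'cont : ContinuousOn τ' (Set.Ici 0)
  hτlb : ∀ t ∈ Set.Ici (0:ℝ), τ0 ≤ τ t
  hτub : ∀ t ∈ Set.Ici (0:ℝ), τ t ≤ τ1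
  hd : d < 1
  hτ'le : ∀ t ∈ Set.Ici (0:ℝ), τ' t ≤ d
  hμ1pos : ∀ t ∈ Set.Ici (0:ℝ), 0 < μ1 t
  hμ1anti : AntitoneOn μ1 (Set.Ici 0)
  hμ1deriv : ∀ t ∈ Set.Ici (0:ℝ), HasDerivAt μ1 (μ1' t) t
  hμ1'cont : ContinuousOn μ1' (Set.Ici 0)
  hM1pos : 0 < M1
  hM1 : ∀ t ∈ Set.Ici (0:ℝ), |μ1' t / μ1 t| ≤ M1
  hμ2deriv : ∀ t ∈ Set.Ici (0:ℝ), HasDerivAt μ2 (μ2' t) t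
  hμ2'cont : ContinuousOn μ2' (Set.Ici 0)
  hβpos : 0 < β
  hβ : β < Real.sqrt (1 - d)
  hμ2bd : ∀ t ∈ Set.Ici (0:ℝ), |μ2 t| ≤ β * μ1 t
  hM2pos : 0 < M2
  hμ2'bd : ∀ t ∈ Set.Ici (0:ℝ), |μ2' t| ≤ M2 * μ1 t

/-- A classical solution `(u,v,z)` of the transmission system, recorded together
with its partial derivatives. -/
structure Solution (S : TransmissionSystem) where
  u : ℝ → ℝ → ℝ
  ux : ℝ → ℝ → ℝ
  uxx : ℝ → ℝ → ℝ
  ut : ℝ → ℝ → ℝ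
  utt : ℝ → ℝ → ℝ
  v : ℝ → ℝ → ℝ
  vx : ℝ → ℝ → ℝ
  vxx : ℝ → ℝ → ℝ
  vt : ℝ → ℝ → ℝ
  vtt : ℝ → ℝ → ℝ
  z : ℝ → ℝ → ℝ → ℝ
  zρ : ℝ → ℝ → ℝ → ℝ
  zt : ℝ → ℝ → ℝ → ℝ
  -- u is of class C² on Ω̄ × [0,∞)
  hux : ∀ x ∈ Omegac S.L1 S.L2 S.L3, ∀ t ∈ Set.Ici (0:ℝ),
    HasDerivAt (fun y => u y t) (ux x t) x
  huxx : ∀ x ∈ Omegac S.L1 S.L2 S.L3, ∀ t ∈ Set.Ici (0:ℝ),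
    HasDerivAt (fun y => ux y t) (uxx x t) x
  hut : ∀ x ∈ Omegac S.L1 S.L2 S.L3, ∀ t ∈ Set.Ici (0:ℝ),
    HasDerivAt (fun s => u x s) (ut x t) t
  hutt : ∀ x ∈ Omegac S.L1 S.L2 S.L3, ∀ t ∈ Set.Ici (0:ℝ),
    HasDerivAt (fun s => ut x s) (utt x t) t
  hucont : ContinuousOn (Function.uncurry u) ((Omegac S.L1 S.L2 S.L3) ×ˢ Set.Ici 0)
  huxcont : ContinuousOn (Function.uncurry ux) ((Omegac S.L1 S.L2 S.L3) ×ˢ Set.Ici 0)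
  huxxcont : ContinuousOn (Function.uncurry uxx) ((Omegac S.L1 S.L2 S.L3) ×ˢ Set.Ici 0)
  hutcont : ContinuousOn (Function.uncurry ut) ((Omegac S.L1 S.L2 S.L3) ×ˢ Set.Ici 0)
  huttcont : ContinuousOn (Function.uncurry utt) ((Omegac S.L1 S.L2 S.L3) ×ˢ Set.Ici 0)
  -- v is of class C² on [L₁,L₂] × [0,∞)
  hvx : ∀ x ∈ Set.Icc S.L1 S.L2, ∀ t ∈ Set.Ici (0:ℝ),
    HasDerivAt (fun y => v y t) (vx x t) x
  hvxx : ∀ x ∈ Set.Icc S.L1 S.L2, ∀ t ∈ Set.Ici (0:ℝ),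
    HasDerivAt (fun y => vx y t) (vxx x t) x
  hvt : ∀ x ∈ Set.Icc S.L1 S.L2, ∀ t ∈ Set.Ici (0:ℝ),
    HasDerivAt (fun s => v x s) (vt x t) t
  hvtt : ∀ x ∈ Set.Icc S.L1 S.L2, ∀ t ∈ Set.Ici (0:ℝ),
    HasDerivAt (fun s => vt x s) (vtt x t) t
  hvcont : ContinuousOn (Function.uncurry v) ((Set.Icc S.L1 S.L2) ×ˢ Set.Ici 0)
  hvxcont : ContinuousOn (Function.uncurry vx) ((Set.Icc S.L1 S.L2) ×ˢ Set.Ici 0)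
  hvxxcont : ContinuousOn (Function.uncurry vxx) ((Set.Icc S.L1 S.L2) ×ˢ Set.Ici 0)
  hvtcont : ContinuousOn (Function.uncurry vt) ((Set.Icc S.L1 S.L2) ×ˢ Set.Ici 0)
  hvttcont : ContinuousOn (Function.uncurry vtt) ((Set.Icc S.L1 S.L2) ×ˢ Set.Ici 0)
  -- z is of class C¹ on Ω̄ × [0,1] × [0,∞)
  hzρ : ∀ x ∈ Omegac S.L1 S.L2 S.L3, ∀ ρ ∈ Set.Icc (0:ℝ) 1, ∀ t ∈ Set.Ici (0:ℝ),
    HasDerivAt (fun r => z x r t) (zρ x ρ t) ρ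
  hzt : ∀ x ∈ Omegac S.L1 S.L2 S.L3, ∀ ρ ∈ Set.Icc (0:ℝ) 1, ∀ t ∈ Set.Ici (0:ℝ),
    HasDerivAt (fun s => z x ρ s) (zt x ρ t) t
  hzcont : ContinuousOn (fun p : ℝ × ℝ × ℝ => z p.1 p.2.1 p.2.2)
    ((Omegac S.L1 S.L2 S.L3) ×ˢ ((Set.Icc 0 1) ×ˢ (Set.Ici 0)))
  hzρcont : ContinuousOn (fun p : ℝ × ℝ × ℝ => zρ p.1 p.2.1 p.2.2)
    ((Omegac S.L1 S.L2 S.L3) ×ˢ ((Set.Icc 0 1) ×ˢ (Set.Ici 0)))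
  hztcont : ContinuousOn (fun p : ℝ × ℝ × ℝ => zt p.1 p.2.1 p.2.2)
    ((Omegac S.L1 S.L2 S.L3) ×ˢ ((Set.Icc 0 1) ×ˢ (Set.Ici 0)))
  -- the wave equation with delayed damping on Ω × (0,∞)
  hueq : ∀ x ∈ Omegao S.L1 S.L2 S.L3, ∀ t ∈ Set.Ioi (0:ℝ),
    utt x t = S.a * uxx x t - S.μ1 t * ut x t - S.μ2 t * z x 1 t
  -- the free wave equation on (L₁,L₂) × (0,∞)
  hveq : ∀ x ∈ Set.Ioo S.L1 S.L2, ∀ t ∈ Set.Ioi (0:ℝ),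
    vtt x t = S.b * vxx x t
  -- the transport equation for z on Ω × (0,1) × (0,∞)
  hzeq : ∀ x ∈ Omegao S.L1 S.L2 S.L3, ∀ ρ ∈ Set.Ioo (0:ℝ) 1, ∀ t ∈ Set.Ioi (0:ℝ),
    S.τ t * zt x ρ t + (1 - S.τ' t * ρ) * zρ x ρ t = 0
  -- z(x,0,t) = u_t(x,t)
  hz0 : ∀ x ∈ Omegac S.L1 S.L2 S.L3, ∀ t ∈ Set.Ici (0:ℝ), z x 0 t = ut x t
  -- transmission conditions
  htrans1 : ∀ t ∈ Set.Ici (0:ℝ), u S.L1 t = v S.L1 t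
  htrans2 : ∀ t ∈ Set.Ici (0:ℝ), u S.L2 t = v S.L2 t
  htrans3 : ∀ t ∈ Set.Ici (0:ℝ), S.a * ux S.L1 t = S.b * vx S.L1 t
  htrans4 : ∀ t ∈ Set.Ici (0:ℝ), S.a * ux S.L2 t = S.b * vx S.L2 t
  -- boundary conditions
  hbc0 : ∀ t ∈ Set.Ici (0:ℝ), u 0 t = 0
  hbcL3 : ∀ t ∈ Set.Ici (0:ℝ), u S.L3 t = 0

/-- The total energy of the system, with `ξ(t) = ξ̄ μ₁(t)`. -/
def energy (S : TransmissionSystem) (sol : Solution S) (ξb : ℝ) (t : ℝ) : ℝ :=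
  (1/2) * ((∫ x in (0:ℝ)..S.L1, (sol.ut x t)^2 + S.a * (sol.ux x t)^2)
    + ∫ x in S.L2..S.L3, (sol.ut x t)^2 + S.a * (sol.ux x t)^2)
  + (1/2) * (∫ x in S.L1..S.L2, (sol.vt x t)^2 + S.b * (sol.vx x t)^2)
  + (ξb * S.μ1 t * S.τ t / 2) *
    ((∫ x in (0:ℝ)..S.L1, ∫ ρ in (0:ℝ)..1, (sol.z x ρ t)^2)
      + ∫ x in S.L2..S.L3, ∫ ρ in (0:ℝ)..1, (sol.z x ρ t)^2)

open Filter Topology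

lemma continuousOn_intervalIntegral {X : Type*} [TopologicalSpace X] {F : X → ℝ → ℝ}
    {s : Set X} {a b : ℝ} (hab : a ≤ b)
    (hF : ContinuousOn (fun p : X × ℝ => F p.1 p.2) (s ×ˢ Icc a b)) :
    ContinuousOn (fun x => ∫ y in a..b, F x y) s := by
  rw [continuousOn_iff_continuous_domRestrict]
  have hc : Continuous (Function.uncurry fun (x : s) (y : ℝ) => F x (projIcc a b hab y)) :=
    hF.comp_continuous
      (f := fun q : s × ℝ => ((q.1 : X), (projIcc a b hab q.2 : ℝ)))
      ((continuous_subtype_val.comp continuous_fst).prodMk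
        (continuous_subtype_val.comp (continuous_projIcc.comp continuous_snd)))
      (fun q => ⟨q.1.2, (projIcc a b hab q.2).2⟩)
  refine (continuous_parametric_intervalIntegral_of_continuous' (μ := volume) hc a b).congr ?_
  intro x
  refine integral_congr fun y hy => ?_
  rw [uIcc_of_le hab] at hy
  simp [projIcc_of_mem hab hy]

lemma continuousOn_slice {F : ℝ → ℝ → ℝ} {A T : Set ℝ}
    (hF : ContinuousOn (Function.uncurry F) (A ×ˢ T)) {t : ℝ} (ht : t ∈ T) :
    ContinuousOn (fun x => F x t) A :=
  hF.comp (f := fun x => (x, t)) (by fun_prop) fun _ hx => ⟨hx, ht⟩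

lemma continuousOn_intervalIntegral_left {F : ℝ → ℝ → ℝ} {T : Set ℝ} {a b : ℝ} (hab : a ≤ b)
    (hF : ContinuousOn (Function.uncurry F) (Icc a b ×ˢ T)) :
    ContinuousOn (fun t => ∫ x in a..b, F x t) T :=
  continuousOn_intervalIntegral (F := fun t x => F x t) hab
    (hF.comp continuous_swap.continuousOn fun _ hp => ⟨hp.2, hp.1⟩)

/-- Only one factor needs a time derivative: the increment of `f` vanishes at the base point. -/
lemma hasDerivAt_integral_sub_mul {f f' w : ℝ → ℝ → ℝ} {a b t : ℝ} (hab : a ≤ b) (ht : 0 < t)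
    (hf : ∀ x ∈ Icc a b, ∀ s ∈ Ioi (0:ℝ), HasDerivAt (fun r => f x r) (f' x s) s)
    (hf' : ContinuousOn (Function.uncurry f') (Icc a b ×ˢ Ioi 0))
    (hw : ContinuousOn (Function.uncurry w) (Icc a b ×ˢ Ioi 0)) :
    HasDerivAt (fun s => ∫ x in a..b, (f x s - f x t) * w x s)
      (∫ x in a..b, f' x t * w x t) t := by
  have hmem : ∀ s ∈ Ioi (0:ℝ), ∀ θ ∈ Icc (0:ℝ) 1, t + θ * (s - t) ∈ Ioi (0:ℝ) := by
    intro s hs θ hθ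
    simpa using (convex_Ioi (0:ℝ)).add_smul_sub_mem ht hs hθ
  set q : ℝ → ℝ → ℝ := fun x s => ∫ θ in (0:ℝ)..1, f' x (t + θ * (s - t)) with hq
  have hqc : ContinuousOn (Function.uncurry q) (Icc a b ×ˢ Ioi 0) := by
    refine continuousOn_intervalIntegral
      (F := fun (p : ℝ × ℝ) θ => f' p.1 (t + θ * (p.2 - t))) zero_le_one ?_
    exact hf'.comp (f := fun r : (ℝ × ℝ) × ℝ => (r.1.1, t + r.2 * (r.1.2 - t))) (by fun_prop)
      fun r hr => ⟨hr.1.1, hmem _ hr.1.2 _ hr.2⟩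
  have hfq : ∀ x ∈ Icc a b, ∀ s ∈ Ioi (0:ℝ), f x s - f x t = (s - t) * q x s := by
    intro x hx s hs
    have hderiv : ∀ θ ∈ uIcc (0:ℝ) 1, HasDerivAt (fun θ => f x (t + θ * (s - t)))
        (f' x (t + θ * (s - t)) * (s - t)) θ := by
      intro θ hθ
      rw [uIcc_of_le zero_le_one] at hθ
      have hlin : HasDerivAt (fun θ : ℝ => t + θ * (s - t)) (s - t) θ := by
        simpa using ((hasDerivAt_id θ).mul_const (s - t)).const_add t
      exact (hf x hx _ (hmem s hs θ hθ)).comp θ hlin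
    have hcont : ContinuousOn (fun θ => f' x (t + θ * (s - t)) * (s - t)) (uIcc (0:ℝ) 1) := by
      rw [uIcc_of_le zero_le_one]
      refine ContinuousOn.mul ?_ continuousOn_const
      exact hf'.comp (f := fun θ : ℝ => (x, t + θ * (s - t))) (by fun_prop)
        fun θ hθ => ⟨hx, hmem s hs θ hθ⟩
    have := integral_eq_sub_of_hasDerivAt hderiv hcont.intervalIntegrable
    rw [intervalIntegral.integral_mul_const] at this
    simp only [one_mul, zero_mul, add_zero, add_sub_cancel] at this
    rw [← this, hq, mul_comm]
  have hG : ContinuousAt (fun s => ∫ x in a..b, q x s * w x s) t :=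
    (continuousOn_intervalIntegral_left (F := fun x s => q x s * w x s) hab
      (hqc.mul hw)).continuousAt (Ioi_mem_nhds ht)
  have hGt : ∫ x in a..b, q x t * w x t = ∫ x in a..b, f' x t * w x t := by simp [hq]
  rw [hasDerivAt_iff_tendsto_slope, ← hGt]
  refine (hG.tendsto.mono_left nhdsWithin_le_nhds).congr' ?_
  filter_upwards [self_mem_nhdsWithin, nhdsWithin_le_nhds (Ioi_mem_nhds ht)] with s hst hs
  have hne : s - t ≠ 0 := sub_ne_zero.2 hst
  have : ∫ x in a..b, (f x s - f x t) * w x s = (s - t) * ∫ x in a..b, q x s * w x s := by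
    rw [← intervalIntegral.integral_const_mul]
    refine integral_congr fun x hx => ?_
    rw [uIcc_of_le hab] at hx
    simp only [hfq x hx s hs, mul_assoc]
  rw [slope_def_field, this]
  simp [hne]

lemma hasDerivAt_intervalIntegral {f f' : ℝ → ℝ → ℝ} {a b t : ℝ} (hab : a ≤ b) (ht : 0 < t)
    (hf : ∀ x ∈ Icc a b, ∀ s ∈ Ioi (0:ℝ), HasDerivAt (fun r => f x r) (f' x s) s)
    (hfc : ContinuousOn (Function.uncurry f) (Icc a b ×ˢ Ioi 0))
    (hf' : ContinuousOn (Function.uncurry f') (Icc a b ×ˢ Ioi 0)) :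
    HasDerivAt (fun s => ∫ x in a..b, f x s) (∫ x in a..b, f' x t) t := by
  have h := (hasDerivAt_integral_sub_mul (w := fun _ _ => 1) hab ht hf hf'
    continuousOn_const).add_const (∫ x in a..b, f x t)
  simp only [mul_one] at h
  refine h.congr_of_eventuallyEq ?_
  filter_upwards [Ioi_mem_nhds ht] with s hs
  have hi : ∀ r ∈ Ioi (0:ℝ), IntervalIntegrable (fun x => f x r) volume a b := fun r hr =>
    (uIcc_of_le hab ▸ continuousOn_slice hfc hr).intervalIntegrable
  rw [intervalIntegral.integral_sub (hi s hs) (hi t ht), sub_add_cancel]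

lemma hasDerivAt_wave_energy {w wx wxx wt wtt : ℝ → ℝ → ℝ} {a b c t : ℝ} (hab : a ≤ b)
    (ht : 0 < t)
    (hwx : ∀ x ∈ Icc a b, ∀ s ∈ Ioi (0:ℝ), HasDerivAt (fun y => w y s) (wx x s) x)
    (hwxx : ∀ x ∈ Icc a b, ∀ s ∈ Ioi (0:ℝ), HasDerivAt (fun y => wx y s) (wxx x s) x)
    (hwt : ∀ x ∈ Icc a b, ∀ s ∈ Ioi (0:ℝ), HasDerivAt (fun r => w x r) (wt x s) s)
    (hwtt : ∀ x ∈ Icc a b, ∀ s ∈ Ioi (0:ℝ), HasDerivAt (fun r => wt x r) (wtt x s) s)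
    (hwxc : ContinuousOn (Function.uncurry wx) (Icc a b ×ˢ Ioi 0))
    (hwxxc : ContinuousOn (Function.uncurry wxx) (Icc a b ×ˢ Ioi 0))
    (hwtc : ContinuousOn (Function.uncurry wt) (Icc a b ×ˢ Ioi 0))
    (hwttc : ContinuousOn (Function.uncurry wtt) (Icc a b ×ˢ Ioi 0)) :
    HasDerivAt (fun s => ∫ x in a..b, (wt x s) ^ 2 + c * (wx x s) ^ 2)
      (2 * (c * (wt b t * wx b t - wt a t * wx a t)
        + ∫ x in a..b, wt x t * (wtt x t - c * wxx x t))) t := by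
  have ii : ∀ {g : ℝ → ℝ}, ContinuousOn g (Icc a b) → IntervalIntegrable g volume a b :=
    fun hg => (uIcc_of_le hab ▸ hg).intervalIntegrable
  have hkin : HasDerivAt (fun s => ∫ x in a..b, (wt x s) ^ 2)
      (∫ x in a..b, 2 * wt x t * wtt x t) t := by
    refine hasDerivAt_intervalIntegral (f' := fun x s => 2 * wt x s * wtt x s) hab ht ?_
      (hwtc.pow 2) ((hwtc.const_mul 2).mul hwttc)
    intro x hx s hs
    simpa using (hwtt x hx s hs).fun_pow 2
  -- integrating the increment of `wx ^ 2` by parts in space avoids the mixed derivative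
  have hincr : ∀ s ∈ Ioi (0:ℝ), ∫ x in a..b, (wx x s) ^ 2 =
      (∫ x in a..b, (wx x t) ^ 2) + ((w b s - w b t) * (wx b s + wx b t)
        - (w a s - w a t) * (wx a s + wx a t)
        - ∫ x in a..b, (w x s - w x t) * (wxx x s + wxx x t)) := by
    intro s hs
    have hct := fun {r} (hr : r ∈ Ioi (0:ℝ)) => continuousOn_slice hwxc hr
    have hctt := fun {r} (hr : r ∈ Ioi (0:ℝ)) => continuousOn_slice hwxxc hr
    have hp := integral_mul_deriv_eq_deriv_mul (a := a) (b := b)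
      (u := fun x => w x s - w x t) (v := fun x => wx x s + wx x t)
      (u' := fun x => wx x s - wx x t) (v' := fun x => wxx x s + wxx x t)
      (fun x hx => by
        rw [uIcc_of_le hab] at hx
        exact (hwx x hx s hs).sub (hwx x hx t ht))
      (fun x hx => by
        rw [uIcc_of_le hab] at hx
        exact (hwxx x hx s hs).add (hwxx x hx t ht))
      (ii ((hct hs).sub (hct ht))) (ii ((hctt hs).add (hctt ht)))
    have hd : ∫ x in a..b, (wx x s - wx x t) * (wx x s + wx x t) =
        (∫ x in a..b, (wx x s) ^ 2) - ∫ x in a..b, (wx x t) ^ 2 := by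
      have h1 := hct hs
      have h2 := hct ht
      rw [← intervalIntegral.integral_sub (ii (by fun_prop)) (ii (by fun_prop))]
      exact integral_congr fun x _ => by ring
    rw [hd] at hp
    linarith
  have hbdry : ∀ x ∈ Icc a b, HasDerivAt (fun s => (w x s - w x t) * (wx x s + wx x t))
      (2 * wt x t * wx x t) t := by
    intro x hx
    have hwxt : ContinuousAt (fun s => wx x s) t :=
      ContinuousOn.continuousAt (s := Ioi (0:ℝ)) (hwxc.comp (f := fun s => (x, s)) (by fun_prop)
        fun s hs => ⟨hx, hs⟩) (Ioi_mem_nhds ht)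
    rw [hasDerivAt_iff_tendsto_slope]
    have h1 := (hasDerivAt_iff_tendsto_slope.1 (hwt x hx t ht)).mul
      ((hwxt.add (continuousAt_const (y := wx x t))).tendsto.mono_left nhdsWithin_le_nhds)
    rw [show 2 * wt x t * wx x t = wt x t * (wx x t + wx x t) by ring]
    refine h1.congr fun s => ?_
    simp only [slope_def_field, Pi.add_apply]
    ring
  have hpot : HasDerivAt (fun s => ∫ x in a..b, (wx x s) ^ 2)
      (2 * wt b t * wx b t - 2 * wt a t * wx a t
        - ∫ x in a..b, wt x t * (wxx x t + wxx x t)) t := by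
    have hvol := hasDerivAt_integral_sub_mul (w := fun x s => wxx x s + wxx x t) hab ht hwt hwtc
      (hwxxc.add ((continuousOn_slice hwxxc (mem_Ioi.2 ht)).comp continuousOn_fst
        fun p hp => hp.1))
    refine ((((hbdry b (right_mem_Icc.2 hab)).sub (hbdry a (left_mem_Icc.2 hab))).sub
      hvol).const_add (∫ x in a..b, (wx x t) ^ 2)).congr_of_eventuallyEq ?_
    filter_upwards [Ioi_mem_nhds ht] with s hs using hincr s hs
  have hsum := hkin.add (hpot.const_mul c)
  have hcx := continuousOn_slice hwxxc (mem_Ioi.2 ht)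
  have hct := continuousOn_slice hwtc (mem_Ioi.2 ht)
  have hctt := continuousOn_slice hwttc (mem_Ioi.2 ht)
  have hval : (2 * (c * (wt b t * wx b t - wt a t * wx a t)
        + ∫ x in a..b, wt x t * (wtt x t - c * wxx x t))) =
      (∫ x in a..b, 2 * wt x t * wtt x t) + c * (2 * wt b t * wx b t - 2 * wt a t * wx a t
        - ∫ x in a..b, wt x t * (wxx x t + wxx x t)) := by
    have : 2 * ∫ x in a..b, wt x t * (wtt x t - c * wxx x t) =
        (∫ x in a..b, 2 * wt x t * wtt x t) - c * ∫ x in a..b, wt x t * (wxx x t + wxx x t) := by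
      rw [← intervalIntegral.integral_const_mul, ← intervalIntegral.integral_const_mul,
        ← intervalIntegral.integral_sub (ii (by fun_prop)) (ii (by fun_prop))]
      exact integral_congr fun x _ => by ring
    linear_combination this
  rw [hval]
  refine hsum.congr_of_eventuallyEq ?_
  filter_upwards [Ioi_mem_nhds ht] with s hs
  have h1 := continuousOn_slice hwtc hs
  have h2 := continuousOn_slice hwxc hs
  rw [intervalIntegral.integral_add (ii (by fun_prop)) (ii (by fun_prop)),
    intervalIntegral.integral_const_mul]
  rfl

lemma hasDerivAt_delay_integral {z zρ zt : ℝ → ℝ → ℝ → ℝ} {a b t T T' : ℝ} (hab : a ≤ b)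
    (ht : 0 < t)
    (hzρ : ∀ x ∈ Icc a b, ∀ ρ ∈ Icc (0:ℝ) 1, ∀ s ∈ Ioi (0:ℝ),
      HasDerivAt (fun r => z x r s) (zρ x ρ s) ρ)
    (hzt : ∀ x ∈ Icc a b, ∀ ρ ∈ Icc (0:ℝ) 1, ∀ s ∈ Ioi (0:ℝ),
      HasDerivAt (fun r => z x ρ r) (zt x ρ s) s)
    (hzc : ContinuousOn (fun p : ℝ × ℝ × ℝ => z p.1 p.2.1 p.2.2)
      (Icc a b ×ˢ (Icc 0 1 ×ˢ Ioi 0)))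
    (hzρc : ContinuousOn (fun p : ℝ × ℝ × ℝ => zρ p.1 p.2.1 p.2.2)
      (Icc a b ×ˢ (Icc 0 1 ×ˢ Ioi 0)))
    (hztc : ContinuousOn (fun p : ℝ × ℝ × ℝ => zt p.1 p.2.1 p.2.2)
      (Icc a b ×ˢ (Icc 0 1 ×ˢ Ioi 0)))
    (heq : ∀ x ∈ Ioo a b, ∀ ρ ∈ Ioo (0:ℝ) 1,
      T * zt x ρ t + (1 - T' * ρ) * zρ x ρ t = 0) :
    ∃ K, HasDerivAt (fun s => ∫ x in a..b, ∫ ρ in (0:ℝ)..1, (z x ρ s) ^ 2) K t ∧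
      T * K = (∫ x in a..b, (z x 0 t) ^ 2) - (1 - T') * (∫ x in a..b, (z x 1 t) ^ 2)
        - T' * ∫ x in a..b, ∫ ρ in (0:ℝ)..1, (z x ρ t) ^ 2 := by
  have ii : ∀ {p q : ℝ} {g : ℝ → ℝ}, p ≤ q → ContinuousOn g (Icc p q) →
      IntervalIntegrable g volume p q :=
    fun h hg => (uIcc_of_le h ▸ hg).intervalIntegrable
  have hdc : ContinuousOn (fun p : ℝ × ℝ × ℝ => 2 * z p.1 p.2.1 p.2.2 * zt p.1 p.2.1 p.2.2)
      (Icc a b ×ˢ (Icc 0 1 ×ˢ Ioi 0)) := (hzc.const_mul 2).mul hztc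
  have par : ∀ {g : ℝ → ℝ → ℝ → ℝ}, ContinuousOn (fun p : ℝ × ℝ × ℝ => g p.1 p.2.1 p.2.2)
      (Icc a b ×ˢ (Icc 0 1 ×ˢ Ioi 0)) → ContinuousOn
        (Function.uncurry fun x s => ∫ ρ in (0:ℝ)..1, g x ρ s) (Icc a b ×ˢ Ioi 0) := fun hg =>
    continuousOn_intervalIntegral (F := fun (p : ℝ × ℝ) ρ => _) zero_le_one
      (hg.comp (f := fun r : (ℝ × ℝ) × ℝ => (r.1.1, r.2, r.1.2)) (by fun_prop)
        fun r hr => ⟨hr.1.1, hr.2, hr.1.2⟩)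
  have fix : ∀ {g : ℝ → ℝ → ℝ → ℝ}, ContinuousOn (fun p : ℝ × ℝ × ℝ => g p.1 p.2.1 p.2.2)
      (Icc a b ×ˢ (Icc 0 1 ×ˢ Ioi 0)) → ∀ x ∈ Icc a b, ContinuousOn
        (Function.uncurry fun ρ s => g x ρ s) (Icc 0 1 ×ˢ Ioi 0) := fun hg x hx =>
    hg.comp (f := fun r : ℝ × ℝ => (x, r)) (by fun_prop) fun r hr => ⟨hx, hr⟩
  have edge : ∀ ρ ∈ Icc (0:ℝ) 1, ContinuousOn (fun x => z x ρ t) (Icc a b) := fun ρ hρ =>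
    hzc.comp (f := fun x => (x, ρ, t)) (by fun_prop) fun x hx => ⟨hx, hρ, ht⟩
  refine ⟨∫ x in a..b, ∫ ρ in (0:ℝ)..1, 2 * z x ρ t * zt x ρ t, ?_, ?_⟩
  · refine hasDerivAt_intervalIntegral (f := fun x s => ∫ ρ in (0:ℝ)..1, (z x ρ s) ^ 2)
      (f' := fun x s => ∫ ρ in (0:ℝ)..1, 2 * z x ρ s * zt x ρ s)
      hab ht ?_ (par (hzc.pow 2)) (par hdc)
    intro x hx s hs
    refine hasDerivAt_intervalIntegral (f := fun ρ s => (z x ρ s) ^ 2)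
      (f' := fun ρ s => 2 * z x ρ s * zt x ρ s) zero_le_one hs ?_
      (fix (g := fun x ρ s => (z x ρ s) ^ 2) (hzc.pow 2) x hx)
      (fix (g := fun x ρ s => 2 * z x ρ s * zt x ρ s) hdc x hx)
    intro ρ hρ r hr
    simpa using (hzt x hx ρ hρ r hr).fun_pow 2
  · have hinner : ∀ x ∈ Ioo a b, T * ∫ ρ in (0:ℝ)..1, 2 * z x ρ t * zt x ρ t =
        (z x 0 t) ^ 2 - (1 - T') * (z x 1 t) ^ 2 - T' * ∫ ρ in (0:ℝ)..1, (z x ρ t) ^ 2 := by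
      intro x hx
      have hx' := Ioo_subset_Icc_self hx
      have h1 := continuousOn_slice (fix hzc x hx') ht
      have h2 := continuousOn_slice (fix hzρc x hx') ht
      have hp := integral_mul_deriv_eq_deriv_mul (a := (0:ℝ)) (b := 1)
        (u := fun ρ => 1 - T' * ρ) (v := fun ρ => (z x ρ t) ^ 2)
        (u' := fun _ => -T') (v' := fun ρ => 2 * z x ρ t * zρ x ρ t)
        (fun ρ _ => by simpa using ((hasDerivAt_id ρ).const_mul T').const_sub 1)
        (fun ρ hρ => by
          rw [uIcc_of_le zero_le_one] at hρ
          simpa using (hzρ x hx' ρ hρ t ht).fun_pow 2)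
        (ii zero_le_one (by fun_prop)) (ii zero_le_one (by fun_prop))
      have hq : T * ∫ ρ in (0:ℝ)..1, 2 * z x ρ t * zt x ρ t =
          -∫ ρ in (0:ℝ)..1, (1 - T' * ρ) * (2 * z x ρ t * zρ x ρ t) := by
        rw [← intervalIntegral.integral_const_mul, ← intervalIntegral.integral_neg]
        refine integral_congr_Ioo_of_le zero_le_one fun ρ hρ => ?_
        linear_combination 2 * z x ρ t * heq x hx ρ hρ
      rw [intervalIntegral.integral_const_mul] at hp
      rw [hq, hp]
      ring
    have h0 := edge 0 (by simp)
    have h1 := edge 1 (by simp)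
    have hJ := continuousOn_slice (par (g := fun x ρ s => (z x ρ s) ^ 2) (hzc.pow 2)) ht
    rw [← intervalIntegral.integral_const_mul, ← intervalIntegral.integral_const_mul,
      ← intervalIntegral.integral_const_mul,
      ← intervalIntegral.integral_sub (ii hab (by fun_prop)) (ii hab (by fun_prop)),
      ← intervalIntegral.integral_sub (ii hab (by fun_prop)) (ii hab (by fun_prop))]
    exact integral_congr_Ioo_of_le hab hinner

lemma damped_segment_derivatives (S : TransmissionSystem) (sol : Solution S) {p q t : ℝ}
    (hpq : p ≤ q) (ht : 0 < t) (hc : Icc p q ⊆ Omegac S.L1 S.L2 S.L3)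
    (ho : Ioo p q ⊆ Omegao S.L1 S.L2 S.L3) :
    ∃ W K, HasDerivAt (fun s => ∫ x in p..q, (sol.ut x s) ^ 2 + S.a * (sol.ux x s) ^ 2) W t ∧
      HasDerivAt (fun s => ∫ x in p..q, ∫ ρ in (0:ℝ)..1, (sol.z x ρ s) ^ 2) K t ∧
      W ≤ 2 * S.a * (sol.ut q t * sol.ux q t - sol.ut p t * sol.ux p t)
        - S.μ1 t * (2 - S.β / √(1 - S.d)) * (∫ x in p..q, (sol.ut x t) ^ 2)
        + S.μ1 t * S.β * √(1 - S.d) * (∫ x in p..q, (sol.z x 1 t) ^ 2) ∧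
      S.τ t * K = (∫ x in p..q, (sol.ut x t) ^ 2)
        - (1 - S.τ' t) * (∫ x in p..q, (sol.z x 1 t) ^ 2)
        - S.τ' t * ∫ x in p..q, ∫ ρ in (0:ℝ)..1, (sol.z x ρ t) ^ 2 := by
  have hI : Ioi (0:ℝ) ⊆ Ici 0 := Ioi_subset_Ici_self
  have h2 : Icc p q ×ˢ Ioi (0:ℝ) ⊆ Omegac S.L1 S.L2 S.L3 ×ˢ Ici 0 := prod_mono hc hI
  have h3 : Icc p q ×ˢ (Icc (0:ℝ) 1 ×ˢ Ioi (0:ℝ)) ⊆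
      Omegac S.L1 S.L2 S.L3 ×ˢ (Icc (0:ℝ) 1 ×ˢ Ici 0) := prod_mono hc (prod_mono_right hI)
  have hW := hasDerivAt_wave_energy (c := S.a) hpq ht
    (fun x hx s hs => sol.hux x (hc hx) s (hI hs)) (fun x hx s hs => sol.huxx x (hc hx) s (hI hs))
    (fun x hx s hs => sol.hut x (hc hx) s (hI hs)) (fun x hx s hs => sol.hutt x (hc hx) s (hI hs))
    (sol.huxcont.mono h2) (sol.huxxcont.mono h2) (sol.hutcont.mono h2) (sol.huttcont.mono h2)
  obtain ⟨K, hK, hKeq⟩ := hasDerivAt_delay_integral (T := S.τ t) (T' := S.τ' t) hpq ht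
    (fun x hx ρ hρ s hs => sol.hzρ x (hc hx) ρ hρ s (hI hs))
    (fun x hx ρ hρ s hs => sol.hzt x (hc hx) ρ hρ s (hI hs))
    (sol.hzcont.mono h3) (sol.hzρcont.mono h3) (sol.hztcont.mono h3)
    (fun x hx ρ hρ => sol.hzeq x (ho hx) ρ hρ t ht)
  refine ⟨_, K, hW, hK, ?_, ?_⟩
  · have ii : ∀ {g : ℝ → ℝ}, ContinuousOn g (Icc p q) → IntervalIntegrable g volume p q :=
      fun hg => (uIcc_of_le hpq ▸ hg).intervalIntegrable
    have hut := continuousOn_slice (sol.hutcont.mono h2) ht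
    have hz1 : ContinuousOn (fun x => sol.z x 1 t) (Icc p q) :=
      sol.hzcont.comp (f := fun x => (x, 1, t)) (by fun_prop)
        fun x hx => ⟨hc hx, by simp, ht.le⟩
    have hr : 0 < √(1 - S.d) := Real.sqrt_pos.2 (sub_pos.2 S.hd)
    have hμ := S.hμ1pos t ht.le
    have hyoung : ∀ y w : ℝ, -(2 * y * (S.μ1 t * y + S.μ2 t * w)) ≤
        -(S.μ1 t * (2 - S.β / √(1 - S.d))) * y ^ 2 + S.μ1 t * S.β * √(1 - S.d) * w ^ 2 := by
      intro y w
      have e1 : -(2 * (S.μ2 t * (y * w))) ≤ 2 * (S.β * S.μ1 t * (|y| * |w|)) := by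
        have := mul_le_mul_of_nonneg_right (S.hμ2bd t ht.le) (abs_nonneg (y * w))
        rw [← abs_mul, abs_mul y w] at this
        have := neg_abs_le (S.μ2 t * (y * w))
        linarith
      have e2 : 2 * (|y| * |w|) ≤ y ^ 2 / √(1 - S.d) + √(1 - S.d) * w ^ 2 := by
        have hs : y ^ 2 / √(1 - S.d) + √(1 - S.d) * w ^ 2 - 2 * (|y| * |w|) =
            (|y| - √(1 - S.d) * |w|) ^ 2 / √(1 - S.d) := by
          rw [← sq_abs y, ← sq_abs w]
          field_simp
          ring
        have : 0 ≤ (|y| - √(1 - S.d) * |w|) ^ 2 / √(1 - S.d) := by positivity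
        linarith
      have e3 := mul_le_mul_of_nonneg_left e2 (mul_pos S.hβpos hμ).le
      have e4 : S.β * S.μ1 t * (y ^ 2 / √(1 - S.d)) = S.μ1 t * (S.β / √(1 - S.d)) * y ^ 2 := by
        ring
      linarith
    have hmono : 2 * ∫ x in p..q, sol.ut x t * (sol.utt x t - S.a * sol.uxx x t) ≤
        -(S.μ1 t * (2 - S.β / √(1 - S.d))) * (∫ x in p..q, (sol.ut x t) ^ 2)
        + S.μ1 t * S.β * √(1 - S.d) * (∫ x in p..q, (sol.z x 1 t) ^ 2) := by
      have heq : 2 * ∫ x in p..q, sol.ut x t * (sol.utt x t - S.a * sol.uxx x t) =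
          ∫ x in p..q, -(2 * sol.ut x t * (S.μ1 t * sol.ut x t + S.μ2 t * sol.z x 1 t)) := by
        rw [← intervalIntegral.integral_const_mul]
        refine integral_congr_Ioo_of_le hpq fun x hx => ?_
        simp only [sol.hueq x (ho hx) t ht]
        ring
      rw [heq, ← intervalIntegral.integral_const_mul, ← intervalIntegral.integral_const_mul,
        ← intervalIntegral.integral_add (ii (by fun_prop)) (ii (by fun_prop))]
      exact intervalIntegral.integral_mono_on hpq (ii (by fun_prop)) (ii (by fun_prop))
        fun x _ => hyoung _ _
    linarith
  · rw [hKeq]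
    congr 2
    refine integral_congr fun x hx => ?_
    rw [uIcc_of_le hpq] at hx
    simp only [sol.hz0 x (hc hx) t ht.le]

lemma continuousOn_energy (S : TransmissionSystem) (sol : Solution S) (ξb : ℝ) :
    ContinuousOn (energy S sol ξb) (Ici 0) := by
  have hc1 : Icc 0 S.L1 ⊆ Omegac S.L1 S.L2 S.L3 := subset_union_left
  have hc2 : Icc S.L2 S.L3 ⊆ Omegac S.L1 S.L2 S.L3 := subset_union_right
  have hwave : ∀ {p q : ℝ}, p ≤ q → Icc p q ⊆ Omegac S.L1 S.L2 S.L3 → ContinuousOn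
      (fun s => ∫ x in p..q, (sol.ut x s) ^ 2 + S.a * (sol.ux x s) ^ 2) (Ici 0) := fun h hc =>
    continuousOn_intervalIntegral_left (F := fun x s => (sol.ut x s) ^ 2 + S.a * (sol.ux x s) ^ 2)
      h (((sol.hutcont.pow 2).add ((sol.huxcont.pow 2).const_mul S.a)).mono
        (prod_mono_left hc))
  have hdelay : ∀ {p q : ℝ}, p ≤ q → Icc p q ⊆ Omegac S.L1 S.L2 S.L3 → ContinuousOn
      (fun s => ∫ x in p..q, ∫ ρ in (0:ℝ)..1, (sol.z x ρ s) ^ 2) (Ici 0) := fun h hc =>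
    continuousOn_intervalIntegral_left (F := fun x s => ∫ ρ in (0:ℝ)..1, (sol.z x ρ s) ^ 2) h
      (continuousOn_intervalIntegral (F := fun (r : ℝ × ℝ) ρ => (sol.z r.1 ρ r.2) ^ 2)
        zero_le_one ((sol.hzcont.pow 2).comp
          (f := fun r : (ℝ × ℝ) × ℝ => (r.1.1, r.2, r.1.2)) (by fun_prop)
          fun r hr => ⟨hc hr.1.1, hr.2, hr.1.2⟩))
  have hfree : ContinuousOn
      (fun s => ∫ x in S.L1..S.L2, (sol.vt x s) ^ 2 + S.b * (sol.vx x s) ^ 2) (Ici 0) :=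
    continuousOn_intervalIntegral_left (F := fun x s => (sol.vt x s) ^ 2 + S.b * (sol.vx x s) ^ 2)
      S.hL12.le ((sol.hvtcont.pow 2).add ((sol.hvxcont.pow 2).const_mul S.b))
  have hμ : ContinuousOn S.μ1 (Ici 0) := HasDerivAt.continuousOn S.hμ1deriv
  have hτ : ContinuousOn S.τ (Ici 0) := HasDerivAt.continuousOn S.hτderiv
  have hw1 := hwave S.hL1.le hc1
  have hw2 := hwave S.hL23.le hc2
  have hz1 := hdelay S.hL1.le hc1
  have hz2 := hdelay S.hL23.le hc2
  unfold energy
  exact (((hw1.add hw2).const_mul _).add (hfree.const_mul _)).add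
    ((((hμ.const_mul ξb).mul hτ).div_const 2).mul (hz1.add hz2))

/-- Lemma 2.2: the total energy is dissipated; in particular it is
non-increasing on `[0,∞)`. -/
theorem energy_dissipation (S : TransmissionSystem) (sol : Solution S)
    (ξb : ℝ) (hξb1 : S.β / Real.sqrt (1 - S.d) < ξb)
    (hξb2 : ξb < 2 - S.β / Real.sqrt (1 - S.d)) :
    (∀ t ∈ Set.Ioi (0:ℝ), ∃ D : ℝ,
      HasDerivAt (energy S sol ξb) D t ∧
      D ≤ -(S.μ1 t) * (1 - ξb / 2 - S.β / (2 * Real.sqrt (1 - S.d))) *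
            ((∫ x in (0:ℝ)..S.L1, (sol.ut x t)^2)
              + ∫ x in S.L2..S.L3, (sol.ut x t)^2)
          - S.μ1 t * (ξb * (1 - S.τ' t) / 2 - S.β * Real.sqrt (1 - S.d) / 2) *
            ((∫ x in (0:ℝ)..S.L1, (sol.z x 1 t)^2)
              + ∫ x in S.L2..S.L3, (sol.z x 1 t)^2) ∧
      -(S.μ1 t) * (1 - ξb / 2 - S.β / (2 * Real.sqrt (1 - S.d))) *
            ((∫ x in (0:ℝ)..S.L1, (sol.ut x t)^2)
              + ∫ x in S.L2..S.L3, (sol.ut x t)^2)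
          - S.μ1 t * (ξb * (1 - S.τ' t) / 2 - S.β * Real.sqrt (1 - S.d) / 2) *
            ((∫ x in (0:ℝ)..S.L1, (sol.z x 1 t)^2)
              + ∫ x in S.L2..S.L3, (sol.z x 1 t)^2) ≤ 0) ∧
    AntitoneOn (energy S sol ξb) (Set.Ici 0) := by
  set r := √(1 - S.d) with hrdef
  have hr : 0 < r := Real.sqrt_pos.2 (sub_pos.2 S.hd)
  have hr2 : r ^ 2 = 1 - S.d := Real.sq_sqrt (sub_pos.2 S.hd).le
  have hk : S.β / (2 * r) = S.β / r / 2 := by field_simp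
  have hξ : 0 < ξb := (div_pos S.hβpos hr).trans hξb1
  have hmain : ∀ t ∈ Set.Ioi (0:ℝ), ∃ D : ℝ,
      HasDerivAt (energy S sol ξb) D t ∧
      D ≤ -(S.μ1 t) * (1 - ξb / 2 - S.β / (2 * r)) *
            ((∫ x in (0:ℝ)..S.L1, (sol.ut x t)^2)
              + ∫ x in S.L2..S.L3, (sol.ut x t)^2)
          - S.μ1 t * (ξb * (1 - S.τ' t) / 2 - S.β * r / 2) *
            ((∫ x in (0:ℝ)..S.L1, (sol.z x 1 t)^2)
              + ∫ x in S.L2..S.L3, (sol.z x 1 t)^2) ∧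
      -(S.μ1 t) * (1 - ξb / 2 - S.β / (2 * r)) *
            ((∫ x in (0:ℝ)..S.L1, (sol.ut x t)^2)
              + ∫ x in S.L2..S.L3, (sol.ut x t)^2)
          - S.μ1 t * (ξb * (1 - S.τ' t) / 2 - S.β * r / 2) *
            ((∫ x in (0:ℝ)..S.L1, (sol.z x 1 t)^2)
              + ∫ x in S.L2..S.L3, (sol.z x 1 t)^2) ≤ 0 := by
    intro t ht
    have ht0 : (0:ℝ) < t := ht
    have hI : Ioi (0:ℝ) ⊆ Ici 0 := Ioi_subset_Ici_self
    have hμ := S.hμ1pos t ht0.le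
    have hτ : 0 < S.τ t := S.hτ0.trans_le (S.hτlb t ht0.le)
    obtain ⟨W1, K1, hW1, hK1, hW1le, hK1eq⟩ := damped_segment_derivatives S sol S.hL1.le ht0
      subset_union_left subset_union_left
    obtain ⟨W2, K2, hW2, hK2, hW2le, hK2eq⟩ := damped_segment_derivatives S sol S.hL23.le ht0
      subset_union_right subset_union_right
    have h2 := prod_mono_right (s := Icc S.L1 S.L2) hI
    have hV := hasDerivAt_wave_energy (c := S.b) S.hL12.le ht0
      (fun x hx s hs => sol.hvx x hx s (hI hs)) (fun x hx s hs => sol.hvxx x hx s (hI hs))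
      (fun x hx s hs => sol.hvt x hx s (hI hs)) (fun x hx s hs => sol.hvtt x hx s (hI hs))
      (sol.hvxcont.mono h2) (sol.hvxxcont.mono h2) (sol.hvtcont.mono h2) (sol.hvttcont.mono h2)
    have hfree : ∫ x in S.L1..S.L2, sol.vt x t * (sol.vtt x t - S.b * sol.vxx x t) = 0 := by
      rw [← intervalIntegral.integral_zero (a := S.L1) (b := S.L2) (μ := volume)]
      refine integral_congr_Ioo_of_le S.hL12.le fun x hx => ?_
      simp [sol.hveq x hx t ht]
    rw [hfree, add_zero] at hV
    have m0 : (0:ℝ) ∈ Omegac S.L1 S.L2 S.L3 := Or.inl (left_mem_Icc.2 S.hL1.le)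
    have m1 : S.L1 ∈ Omegac S.L1 S.L2 S.L3 := Or.inl (right_mem_Icc.2 S.hL1.le)
    have m2 : S.L2 ∈ Omegac S.L1 S.L2 S.L3 := Or.inr (left_mem_Icc.2 S.hL23.le)
    have m3 : S.L3 ∈ Omegac S.L1 S.L2 S.L3 := Or.inr (right_mem_Icc.2 S.hL23.le)
    have heqderiv : ∀ {f g : ℝ → ℝ} {f' g' : ℝ}, HasDerivAt f f' t → HasDerivAt g g' t →
        (∀ s ∈ Ici (0:ℝ), f s = g s) → f' = g' := fun hf hg h =>
      hf.unique (hg.congr_of_eventuallyEq (by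
        filter_upwards [Ici_mem_nhds ht0] with s hs using h s hs))
    have b0 : sol.ut 0 t = 0 :=
      heqderiv (sol.hut 0 m0 t ht0.le) (hasDerivAt_const t 0) sol.hbc0
    have b3 : sol.ut S.L3 t = 0 :=
      heqderiv (sol.hut S.L3 m3 t ht0.le) (hasDerivAt_const t 0) sol.hbcL3
    have b1 : sol.ut S.L1 t = sol.vt S.L1 t := heqderiv (sol.hut S.L1 m1 t ht0.le)
      (sol.hvt S.L1 (left_mem_Icc.2 S.hL12.le) t ht0.le) sol.htrans1
    have b2 : sol.ut S.L2 t = sol.vt S.L2 t := heqderiv (sol.hut S.L2 m2 t ht0.le)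
      (sol.hvt S.L2 (right_mem_Icc.2 S.hL12.le) t ht0.le) sol.htrans2
    have c1 := sol.htrans3 t ht0.le
    have c2 := sol.htrans4 t ht0.le
    have hμ' : S.μ1' t ≤ 0 := by
      have h := S.hμ1anti.derivWithin_nonpos (x := t)
      rwa [derivWithin_of_mem_nhds (Ici_mem_nhds ht0), (S.hμ1deriv t ht0.le).deriv] at h
    have nonneg : ∀ {p q : ℝ} {g : ℝ → ℝ}, p ≤ q → (∀ x, 0 ≤ g x) → 0 ≤ ∫ x in p..q, g x :=
      fun h hg => intervalIntegral.integral_nonneg h fun x _ => hg x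
    have hE := (((hW1.add hW2).const_mul (1 / 2)).add (hV.const_mul (1 / 2))).add
      (((((S.hμ1deriv t ht0.le).const_mul ξb).mul (S.hτderiv t ht0.le)).div_const 2).mul
        (hK1.add hK2))
    refine ⟨_, hE, ?_, ?_⟩
    · have hZ1 : 0 ≤ ∫ x in (0:ℝ)..S.L1, ∫ ρ in (0:ℝ)..1, (sol.z x ρ t) ^ 2 :=
        nonneg S.hL1.le fun x => nonneg zero_le_one fun ρ => sq_nonneg _
      have hZ2 : 0 ≤ ∫ x in S.L2..S.L3, ∫ ρ in (0:ℝ)..1, (sol.z x ρ t) ^ 2 :=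
        nonneg S.hL23.le fun x => nonneg zero_le_one fun ρ => sq_nonneg _
      rw [hk]
      simp only [Pi.add_apply, Pi.mul_apply]
      rw [b0, b1] at hW1le
      rw [b2, b3] at hW2le
      generalize (∫ x in (0:ℝ)..S.L1, ∫ ρ in (0:ℝ)..1, (sol.z x ρ t) ^ 2) = Z1 at *
      generalize (∫ x in S.L2..S.L3, ∫ ρ in (0:ℝ)..1, (sol.z x ρ t) ^ 2) = Z2 at *
      generalize (∫ x in (0:ℝ)..S.L1, (sol.z x 1 t) ^ 2) = Y1 at *
      generalize (∫ x in S.L2..S.L3, (sol.z x 1 t) ^ 2) = Y2 at *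
      generalize (∫ x in (0:ℝ)..S.L1, (sol.ut x t) ^ 2) = X1 at *
      generalize (∫ x in S.L2..S.L3, (sol.ut x t) ^ 2) = X2 at *
      have hneg : ξb * S.μ1' t * S.τ t / 2 * (Z1 + Z2) ≤ 0 := by
        have := mul_nonneg (mul_nonneg hξ.le (neg_nonneg.2 hμ'))
          (mul_nonneg hτ.le (add_nonneg hZ1 hZ2))
        linarith
      have hsplit : ξb * S.μ1 t * S.τ t / 2 * (K1 + K2) =
          ξb * S.μ1 t / 2 * (X1 + X2 - (1 - S.τ' t) * (Y1 + Y2) - S.τ' t * (Z1 + Z2)) := by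
        linear_combination ξb * S.μ1 t / 2 * (hK1eq + hK2eq)
      have d1 : 2 * S.a * (sol.vt S.L1 t * sol.ux S.L1 t - 0 * sol.ux 0 t) =
          2 * (S.b * (sol.vt S.L1 t * sol.vx S.L1 t)) := by
        linear_combination 2 * sol.vt S.L1 t * c1
      have d2 : 2 * S.a * (0 * sol.ux S.L3 t - sol.vt S.L2 t * sol.ux S.L2 t) =
          -(2 * (S.b * (sol.vt S.L2 t * sol.vx S.L2 t))) := by
        linear_combination -2 * sol.vt S.L2 t * c2
      rw [d1] at hW1le
      rw [d2] at hW2le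
      rw [← hrdef] at hW1le hW2le
      linarith
    · have hX : 0 ≤ (∫ x in (0:ℝ)..S.L1, (sol.ut x t) ^ 2) + ∫ x in S.L2..S.L3, (sol.ut x t) ^ 2 :=
        add_nonneg (nonneg S.hL1.le fun x => sq_nonneg _) (nonneg S.hL23.le fun x => sq_nonneg _)
      have hY : 0 ≤ (∫ x in (0:ℝ)..S.L1, (sol.z x 1 t) ^ 2) +
          ∫ x in S.L2..S.L3, (sol.z x 1 t) ^ 2 :=
        add_nonneg (nonneg S.hL1.le fun x => sq_nonneg _) (nonneg S.hL23.le fun x => sq_nonneg _)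
      have hA : 0 ≤ 1 - ξb / 2 - S.β / (2 * r) := by rw [hk]; linarith
      have hB : 0 ≤ ξb * (1 - S.τ' t) / 2 - S.β * r / 2 := by
        have e1 : S.β * r ≤ ξb * r ^ 2 := by
          have := (div_lt_iff₀ hr).1 hξb1
          nlinarith
        have e2 : ξb * r ^ 2 ≤ ξb * (1 - S.τ' t) := by
          rw [hr2]
          exact mul_le_mul_of_nonneg_left (by linarith [S.hτ'le t ht0.le]) hξ.le
        linarith
      have p1 := mul_nonneg (mul_nonneg hμ.le hA) hX
      have p2 := mul_nonneg (mul_nonneg hμ.le hB) hY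
      linarith
  refine ⟨hmain, antitoneOn_of_deriv_nonpos (convex_Ici 0) (continuousOn_energy S sol ξb) ?_ ?_⟩
  · intro t ht
    rw [interior_Ici] at ht
    obtain ⟨D, hD, -⟩ := hmain t ht
    exact hD.differentiableAt.differentiableWithinAt
  · intro t ht
    rw [interior_Ici] at ht
    obtain ⟨D, hD, hle, hle0⟩ := hmain t ht
    rw [hD.deriv]
    exact hle.trans hle0
end
end

section
/- (Lemma 4.1) Let (u,v,z) be a classical solution of the transmission system and define I₁(t) = ∫_Ω u u_t dx + ∫_{L₁}^{L₂} v v_t dx. Then for every ε₁ > 0 and every t > 0, d/dt I₁(t) ≤ −( a − μ₁(0)² c₁² ε₁ ) ∫_Ω u_x² dx − b ∫_{L₁}^{L₂} v_x² dx + ( 1 + 1/(2ε₁) ) ∫_Ω u_t² dx + ∫_{L₁}^{L₂} v_t² dx + (β²/(2ε₁)) ∫_Ω z(x,1,t)² dx, where c₁ = max{L₁, L₃ − L₂}. -/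
open Set Real MeasureTheory intervalIntegral

noncomputable section

/-- Differentiation under the integral sign for an integrand that is `C¹` in time up to `t = 0`. -/
theorem hasDerivAt_integral_of_continuousOn {F F' : ℝ → ℝ → ℝ} {p q t : ℝ} (hpq : p ≤ q)
    (ht : 0 < t)
    (hF : ContinuousOn (Function.uncurry F) (Set.Icc p q ×ˢ Set.Ici 0))
    (hF' : ContinuousOn (Function.uncurry F') (Set.Icc p q ×ˢ Set.Ici 0))
    (hderiv : ∀ x ∈ Set.Icc p q, ∀ s ∈ Set.Ici (0:ℝ), HasDerivAt (F x) (F' x s) s) :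
    HasDerivAt (fun s => ∫ x in p..q, F x s) (∫ x in p..q, F' x t) t := by
  have slice : ∀ {G : ℝ → ℝ → ℝ},
      ContinuousOn (Function.uncurry G) (Set.Icc p q ×ˢ Set.Ici 0) → ∀ s : ℝ, 0 ≤ s →
        IntervalIntegrable (fun x => G x s) volume p q := by
    intro G hG s hs
    apply ContinuousOn.intervalIntegrable_of_Icc hpq
    exact hG.comp (f := fun x => (x, s)) (by fun_prop) fun x hx => ⟨hx, hs⟩
  have hsub : Set.Icc p q ×ˢ Set.Icc (t / 2) (2 * t) ⊆ Set.Icc p q ×ˢ Set.Ici (0:ℝ) :=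
    Set.prod_mono_right fun s hs => (half_pos ht).le.trans hs.1
  obtain ⟨C, hC⟩ :=
    (isCompact_Icc.prod isCompact_Icc).exists_bound_of_continuousOn (hF'.mono hsub)
  have hs : Set.Icc (t / 2) (2 * t) ∈ nhds t := Icc_mem_nhds (by linarith) (by linarith)
  have hIcc : ∀ x ∈ Set.uIoc p q, x ∈ Set.Icc p q := by
    intro x hx
    rw [Set.uIoc_of_le hpq] at hx
    exact Set.Ioc_subset_Icc_self hx
  refine (hasDerivAt_integral_of_dominated_loc_of_deriv_le (F := fun s x => F x s)
    (F' := fun s x => F' x s) (bound := fun _ => C) hs ?_ (slice hF t ht.le) ?_ ?_ ?_ ?_).2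
  · filter_upwards [hs] with s hs
    exact (slice hF s ((half_pos ht).le.trans hs.1)).def'.aestronglyMeasurable
  · exact (slice hF' t ht.le).def'.aestronglyMeasurable
  · exact Filter.Eventually.of_forall fun x hx s hs => hC (x, s) ⟨hIcc x hx, hs⟩
  · exact intervalIntegrable_const
  · exact Filter.Eventually.of_forall fun x hx s hs =>
      hderiv x (hIcc x hx) s ((half_pos ht).le.trans hs.1)

/-- The Cauchy–Schwarz bound for the increment of a `C¹` function. -/
theorem sq_sub_le_mul_integral_sq {f f' : ℝ → ℝ} {p q : ℝ} (hpq : p ≤ q)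
    (hf : ∀ x ∈ Set.Icc p q, HasDerivAt f (f' x) x) (hf' : ContinuousOn f' (Set.Icc p q)) :
    (f q - f p) ^ 2 ≤ (q - p) * ∫ x in p..q, f' x ^ 2 := by
  rcases hpq.eq_or_lt with rfl | hlt
  · simp
  have hint : IntervalIntegrable f' volume p q := hf'.intervalIntegrable_of_Icc hpq
  have hint2 : IntervalIntegrable (fun x => f' x ^ 2) volume p q :=
    (hf'.pow 2).intervalIntegrable_of_Icc hpq
  have hftc : ∫ x in p..q, f' x = f q - f p :=
    integral_eq_sub_of_hasDerivAt (by rwa [Set.uIcc_of_le hpq]) hint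
  set c := (f q - f p) / (q - p) with hc
  have hcm : c * (q - p) = f q - f p := div_mul_cancel₀ _ (sub_pos.2 hlt).ne'
  have hnonneg : 0 ≤ ∫ x in p..q, (f' x - c) ^ 2 := integral_nonneg hpq fun x _ => sq_nonneg _
  have hexp : ∫ x in p..q, (f' x - c) ^ 2
      = (∫ x in p..q, f' x ^ 2) - 2 * c * (f q - f p) + (q - p) * c ^ 2 := by
    have : ∀ x, (f' x - c) ^ 2 = f' x ^ 2 - 2 * c * f' x + c ^ 2 := fun x => by ring
    simp only [this]
    rw [intervalIntegral.integral_add (hint2.sub (hint.const_mul _)) intervalIntegrable_const,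
      intervalIntegral.integral_sub hint2 (hint.const_mul _),
      intervalIntegral.integral_const_mul, hftc, intervalIntegral.integral_const, smul_eq_mul]
  rw [hexp, ← hcm] at hnonneg
  rw [← hcm]
  nlinarith [mul_nonneg (sub_pos.2 hlt).le hnonneg]

/-- The Poincaré inequality for a `C¹` function vanishing at an endpoint. -/
theorem integral_sq_le_mul_integral_deriv_sq {f f' : ℝ → ℝ} {p q : ℝ} (hpq : p ≤ q)
    (hf : ∀ x ∈ Set.Icc p q, HasDerivAt f (f' x) x) (hf' : ContinuousOn f' (Set.Icc p q))
    (h0 : f p = 0 ∨ f q = 0) :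
    ∫ x in p..q, f x ^ 2 ≤ (q - p) ^ 2 * ∫ x in p..q, f' x ^ 2 := by
  have hint2 : IntervalIntegrable (fun x => f' x ^ 2) volume p q :=
    (hf'.pow 2).intervalIntegrable_of_Icc hpq
  have hae : ∀ᵐ x ∂volume.restrict (Set.Ioc p q), 0 ≤ f' x ^ 2 :=
    Filter.Eventually.of_forall fun x => sq_nonneg _
  have hincr : ∀ r s, p ≤ r → r ≤ s → s ≤ q →
      (f s - f r) ^ 2 ≤ (q - p) * ∫ x in p..q, f' x ^ 2 := by
    intro r s hr hrs hs
    have hsub : Set.Icc r s ⊆ Set.Icc p q := Set.Icc_subset_Icc hr hs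
    refine (sq_sub_le_mul_integral_sq hrs (fun x hx => hf x (hsub hx)) (hf'.mono hsub)).trans ?_
    exact mul_le_mul (by linarith) (integral_mono_interval hr hrs hs hae hint2)
      (integral_nonneg hrs fun x _ => sq_nonneg _) (by linarith)
  have hpt : ∀ x ∈ Set.Icc p q, f x ^ 2 ≤ (q - p) * ∫ x in p..q, f' x ^ 2 := by
    intro x hx
    rcases h0 with h0 | h0
    · simpa [h0] using hincr p x le_rfl hx.1 hx.2
    · simpa [h0] using hincr x q hx.1 hx.2 le_rfl
  have hfc : ContinuousOn f (Set.Icc p q) := HasDerivAt.continuousOn hf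
  have hint : IntervalIntegrable (fun x => f x ^ 2) volume p q :=
    (hfc.pow 2).intervalIntegrable_of_Icc hpq
  have := integral_mono_on hpq hint intervalIntegrable_const hpt
  rw [intervalIntegral.integral_const, smul_eq_mul] at this
  linarith

/-- The derivative of `∫ w w_t` over an interval, for `w` of class `C²` in time. -/
theorem hasDerivAt_integral_mul_deriv {w wt wtt : ℝ → ℝ → ℝ} {p q t : ℝ} (hpq : p ≤ q)
    (ht : 0 < t)
    (hw : ContinuousOn (Function.uncurry w) (Set.Icc p q ×ˢ Set.Ici 0))
    (hwt : ContinuousOn (Function.uncurry wt) (Set.Icc p q ×ˢ Set.Ici 0))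
    (hwtt : ContinuousOn (Function.uncurry wtt) (Set.Icc p q ×ˢ Set.Ici 0))
    (hd : ∀ x ∈ Set.Icc p q, ∀ s ∈ Set.Ici (0:ℝ), HasDerivAt (fun s => w x s) (wt x s) s)
    (hdd : ∀ x ∈ Set.Icc p q, ∀ s ∈ Set.Ici (0:ℝ), HasDerivAt (fun s => wt x s) (wtt x s) s) :
    HasDerivAt (fun s => ∫ x in p..q, w x s * wt x s)
      (∫ x in p..q, (wt x t ^ 2 + w x t * wtt x t)) t := by
  refine hasDerivAt_integral_of_continuousOn (F := fun x s => w x s * wt x s)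
    (F' := fun x s => wt x s ^ 2 + w x s * wtt x s) hpq ht (hw.mul hwt)
    ((hwt.pow 2).add (hw.mul hwtt)) fun x hx s hs => ?_
  exact ((hd x hx s hs).mul (hdd x hx s hs)).congr_deriv (by ring)

/-- Integration by parts against the second derivative. -/
theorem integral_mul_deriv_deriv {f f' f'' : ℝ → ℝ} {p q : ℝ} (hpq : p ≤ q)
    (hf : ∀ x ∈ Set.Icc p q, HasDerivAt f (f' x) x)
    (hf' : ∀ x ∈ Set.Icc p q, HasDerivAt f' (f'' x) x)
    (hf'' : ContinuousOn f'' (Set.Icc p q)) :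
    ∫ x in p..q, f x * f'' x = f q * f' q - f p * f' p - ∫ x in p..q, f' x ^ 2 := by
  have hf'c : ContinuousOn f' (Set.Icc p q) := HasDerivAt.continuousOn hf'
  rw [integral_mul_deriv_eq_deriv_mul (by rwa [Set.uIcc_of_le hpq])
    (by rwa [Set.uIcc_of_le hpq]) (hf'c.intervalIntegrable_of_Icc hpq)
    (hf''.intervalIntegrable_of_Icc hpq)]
  simp only [sq]

/-- The pointwise Young inequality absorbing the damping and delay terms. -/
theorem neg_mul_damping_le {m n β ε w y z : ℝ} (hε : 0 < ε) (hn : |n| ≤ β * m) :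
    w * (-m * y - n * z)
      ≤ m ^ 2 * ε * w ^ 2 + 1 / (2 * ε) * y ^ 2 + β ^ 2 / (2 * ε) * z ^ 2 := by
  have hy : -(m * w * y) ≤ ε / 2 * m ^ 2 * w ^ 2 + 1 / (2 * ε) * y ^ 2 := by
    have : ε / 2 * m ^ 2 * w ^ 2 + 1 / (2 * ε) * y ^ 2 + m * w * y
        = (ε * m * w + y) ^ 2 / (2 * ε) := by field_simp; ring
    have h : 0 ≤ (ε * m * w + y) ^ 2 / (2 * ε) := by positivity
    linarith
  have hz : -(n * w * z) ≤ ε / 2 * m ^ 2 * w ^ 2 + β ^ 2 / (2 * ε) * z ^ 2 := by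
    have h1 : -(n * w * z) ≤ β * m * (|w| * |z|) := by
      calc -(n * w * z) ≤ |n * w * z| := neg_le_abs _
        _ = |n| * (|w| * |z|) := by rw [abs_mul, abs_mul, mul_assoc]
        _ ≤ β * m * (|w| * |z|) := by gcongr
    have : ε / 2 * m ^ 2 * |w| ^ 2 + β ^ 2 / (2 * ε) * |z| ^ 2 - β * m * (|w| * |z|)
        = (ε * m * |w| - β * |z|) ^ 2 / (2 * ε) := by field_simp; ring
    have h : 0 ≤ (ε * m * |w| - β * |z|) ^ 2 / (2 * ε) := by positivity
    rw [sq_abs, sq_abs] at this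
    linarith
  linarith

/-- The energy estimate on a damped interval at one end of which the displacement vanishes. -/
theorem integral_damped_wave_le {w w' w'' y y' z : ℝ → ℝ} {p q a m n M c β ε : ℝ} (hpq : p ≤ q)
    (hw : ∀ x ∈ Set.Icc p q, HasDerivAt w (w' x) x)
    (hw' : ∀ x ∈ Set.Icc p q, HasDerivAt w' (w'' x) x)
    (hw'' : ContinuousOn w'' (Set.Icc p q)) (hy : ContinuousOn y (Set.Icc p q))
    (hy' : ContinuousOn y' (Set.Icc p q)) (hz : ContinuousOn z (Set.Icc p q))
    (heq : ∀ x ∈ Set.Ioo p q, y' x = a * w'' x - m * y x - n * z x)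
    (h0 : w p = 0 ∨ w q = 0) (hε : 0 < ε) (hn : |n| ≤ β * m) (hm : 0 ≤ m) (hmM : m ≤ M)
    (hc : q - p ≤ c) :
    ∫ x in p..q, (y x ^ 2 + w x * y' x) ≤
      a * (w q * w' q - w p * w' p) - (a - M ^ 2 * c ^ 2 * ε) * (∫ x in p..q, w' x ^ 2)
        + (1 + 1 / (2 * ε)) * (∫ x in p..q, y x ^ 2)
        + β ^ 2 / (2 * ε) * ∫ x in p..q, z x ^ 2 := by
  have hwc : ContinuousOn w (Set.Icc p q) := HasDerivAt.continuousOn hw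
  have hw'c : ContinuousOn w' (Set.Icc p q) := HasDerivAt.continuousOn hw'
  have ii : ∀ {g : ℝ → ℝ}, ContinuousOn g (Set.Icc p q) → IntervalIntegrable g volume p q :=
    fun hg => hg.intervalIntegrable_of_Icc hpq
  have i1 : IntervalIntegrable (fun x => a * (w x * w'' x)) volume p q :=
    (ii (hwc.mul hw'')).const_mul a
  have i2 : IntervalIntegrable (fun x => m ^ 2 * ε * w x ^ 2) volume p q :=
    (ii (hwc.pow 2)).const_mul (m ^ 2 * ε)
  have i3 : IntervalIntegrable (fun x => (1 + 1 / (2 * ε)) * y x ^ 2) volume p q :=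
    (ii (hy.pow 2)).const_mul (1 + 1 / (2 * ε))
  have i4 : IntervalIntegrable (fun x => β ^ 2 / (2 * ε) * z x ^ 2) volume p q :=
    (ii (hz.pow 2)).const_mul (β ^ 2 / (2 * ε))
  have hmono : ∫ x in p..q, (y x ^ 2 + w x * y' x) ≤
      ∫ x in p..q, (a * (w x * w'' x) + m ^ 2 * ε * w x ^ 2 + (1 + 1 / (2 * ε)) * y x ^ 2
        + β ^ 2 / (2 * ε) * z x ^ 2) := by
    refine integral_mono_on_of_le_Ioo hpq (ii ((hy.pow 2).add (hwc.mul hy')))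
      (((i1.add i2).add i3).add i4) fun x hx => ?_
    have := neg_mul_damping_le (w := w x) (y := y x) (z := z x) hε hn
    rw [heq x hx]
    linarith
  rw [intervalIntegral.integral_add ((i1.add i2).add i3) i4,
    intervalIntegral.integral_add (i1.add i2) i3, intervalIntegral.integral_add i1 i2] at hmono
  simp only [intervalIntegral.integral_const_mul] at hmono
  rw [integral_mul_deriv_deriv hpq hw hw' hw''] at hmono
  have hI : 0 ≤ ∫ x in p..q, w' x ^ 2 := integral_nonneg hpq fun x _ => sq_nonneg _
  have hpq' : 0 ≤ q - p := sub_nonneg.2 hpq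
  have hP : m ^ 2 * ε * (∫ x in p..q, w x ^ 2) ≤ M ^ 2 * c ^ 2 * ε * ∫ x in p..q, w' x ^ 2 :=
    calc m ^ 2 * ε * (∫ x in p..q, w x ^ 2)
        ≤ m ^ 2 * ε * ((q - p) ^ 2 * ∫ x in p..q, w' x ^ 2) := by
          gcongr
          exact integral_sq_le_mul_integral_deriv_sq hpq hw hw'c h0
      _ ≤ M ^ 2 * ε * (c ^ 2 * ∫ x in p..q, w' x ^ 2) := by gcongr
      _ = _ := by ring
  linarith

/-- Lemma 4.1: the estimate for `I₁(t) = ∫_Ω u u_t dx + ∫_{L₁}^{L₂} v v_t dx`,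
where `c₁ = max{L₁, L₃ − L₂}` is the Poincaré constant. -/
theorem I1_estimate (S : TransmissionSystem) (sol : Solution S) :
    ∀ ε1 : ℝ, 0 < ε1 → ∀ t ∈ Set.Ioi (0:ℝ), ∃ D : ℝ,
      HasDerivAt (fun s : ℝ =>
        ((∫ x in (0:ℝ)..S.L1, sol.u x s * sol.ut x s)
          + ∫ x in S.L2..S.L3, sol.u x s * sol.ut x s)
        + ∫ x in S.L1..S.L2, sol.v x s * sol.vt x s) D t ∧
      D ≤ -(S.a - (S.μ1 0)^2 * (max S.L1 (S.L3 - S.L2))^2 * ε1) *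
            ((∫ x in (0:ℝ)..S.L1, (sol.ux x t)^2)
              + ∫ x in S.L2..S.L3, (sol.ux x t)^2)
          - S.b * (∫ x in S.L1..S.L2, (sol.vx x t)^2)
          + (1 + 1 / (2 * ε1)) *
            ((∫ x in (0:ℝ)..S.L1, (sol.ut x t)^2)
              + ∫ x in S.L2..S.L3, (sol.ut x t)^2)
          + (∫ x in S.L1..S.L2, (sol.vt x t)^2)
          + (S.β^2 / (2 * ε1)) *
            ((∫ x in (0:ℝ)..S.L1, (sol.z x 1 t)^2)
              + ∫ x in S.L2..S.L3, (sol.z x 1 t)^2) := by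
  intro ε hε t ht
  have ht0 : t ∈ Set.Ici (0:ℝ) := Set.Ioi_subset_Ici_self ht
  have hleft : Set.Icc 0 S.L1 ⊆ Omegac S.L1 S.L2 S.L3 := Set.subset_union_left
  have hright : Set.Icc S.L2 S.L3 ⊆ Omegac S.L1 S.L2 S.L3 := Set.subset_union_right
  have hderiv : ∀ p q, p ≤ q → Set.Icc p q ⊆ Omegac S.L1 S.L2 S.L3 →
      HasDerivAt (fun s => ∫ x in p..q, sol.u x s * sol.ut x s)
        (∫ x in p..q, (sol.ut x t ^ 2 + sol.u x t * sol.utt x t)) t := by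
    intro p q hpq hsub
    have hprod : Set.Icc p q ×ˢ Set.Ici (0:ℝ) ⊆ Omegac S.L1 S.L2 S.L3 ×ˢ Set.Ici 0 :=
      Set.prod_mono_left hsub
    exact hasDerivAt_integral_mul_deriv hpq ht (sol.hucont.mono hprod) (sol.hutcont.mono hprod)
      (sol.huttcont.mono hprod) (fun x hx => sol.hut x (hsub hx))
      (fun x hx => sol.hutt x (hsub hx))
  have hest : ∀ p q, p ≤ q → Set.Icc p q ⊆ Omegac S.L1 S.L2 S.L3 →
      Set.Ioo p q ⊆ Omegao S.L1 S.L2 S.L3 → (sol.u p t = 0 ∨ sol.u q t = 0) →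
      q - p ≤ max S.L1 (S.L3 - S.L2) →
      ∫ x in p..q, (sol.ut x t ^ 2 + sol.u x t * sol.utt x t) ≤
        S.a * (sol.u q t * sol.ux q t - sol.u p t * sol.ux p t)
          - (S.a - S.μ1 0 ^ 2 * max S.L1 (S.L3 - S.L2) ^ 2 * ε) * (∫ x in p..q, sol.ux x t ^ 2)
          + (1 + 1 / (2 * ε)) * (∫ x in p..q, sol.ut x t ^ 2)
          + S.β ^ 2 / (2 * ε) * ∫ x in p..q, sol.z x 1 t ^ 2 := by
    intro p q hpq hsub hsubo h0 hc
    have slice : ∀ {G : ℝ → ℝ → ℝ},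
        ContinuousOn (Function.uncurry G) (Omegac S.L1 S.L2 S.L3 ×ˢ Set.Ici 0) →
          ContinuousOn (fun x => G x t) (Set.Icc p q) := fun hG =>
      hG.comp (f := fun x => (x, t)) (by fun_prop) fun x hx => ⟨hsub hx, ht0⟩
    have hz : ContinuousOn (fun x => sol.z x 1 t) (Set.Icc p q) :=
      sol.hzcont.comp (f := fun x => (x, 1, t)) (by fun_prop)
        fun x hx => ⟨hsub hx, ⟨zero_le_one, le_rfl⟩, ht0⟩
    exact integral_damped_wave_le hpq (fun x hx => sol.hux x (hsub hx) t ht0)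
      (fun x hx => sol.huxx x (hsub hx) t ht0) (slice sol.huxxcont) (slice sol.hutcont)
      (slice sol.huttcont) hz (fun x hx => sol.hueq x (hsubo hx) t ht) h0 hε (S.hμ2bd t ht0)
      (S.hμ1pos t ht0).le (S.hμ1anti (Set.mem_Ici.2 le_rfl) ht0 ht0) hc
  have hv : ∫ x in S.L1..S.L2, (sol.vt x t ^ 2 + sol.v x t * sol.vtt x t) =
      (∫ x in S.L1..S.L2, sol.vt x t ^ 2)
        + S.b * (sol.v S.L2 t * sol.vx S.L2 t - sol.v S.L1 t * sol.vx S.L1 t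
          - ∫ x in S.L1..S.L2, sol.vx x t ^ 2) := by
    have slice : ∀ {G : ℝ → ℝ → ℝ},
        ContinuousOn (Function.uncurry G) (Set.Icc S.L1 S.L2 ×ˢ Set.Ici 0) →
          ContinuousOn (fun x => G x t) (Set.Icc S.L1 S.L2) := fun hG =>
      hG.comp (f := fun x => (x, t)) (by fun_prop) fun x hx => ⟨hx, ht0⟩
    have hvxxc := slice sol.hvxxcont
    have hkin : IntervalIntegrable (fun x => sol.vt x t ^ 2) volume S.L1 S.L2 :=
      ((slice sol.hvtcont).pow 2).intervalIntegrable_of_Icc S.hL12.le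
    have hpot : IntervalIntegrable (fun x => S.b * (sol.v x t * sol.vxx x t)) volume S.L1 S.L2 :=
      (((slice sol.hvcont).mul hvxxc).intervalIntegrable_of_Icc S.hL12.le).const_mul _
    have heq : ∫ x in S.L1..S.L2, (sol.vt x t ^ 2 + sol.v x t * sol.vtt x t) =
        ∫ x in S.L1..S.L2, (sol.vt x t ^ 2 + S.b * (sol.v x t * sol.vxx x t)) :=
      integral_congr_Ioo_of_le S.hL12.le fun x hx => by
        simp only [sol.hveq x hx t ht]
        ring
    rw [heq, intervalIntegral.integral_add hkin hpot, intervalIntegral.integral_const_mul,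
      integral_mul_deriv_deriv S.hL12.le (fun x hx => sol.hvx x hx t ht0)
        (fun x hx => sol.hvxx x hx t ht0) hvxxc]
  have hest1 := hest 0 S.L1 S.hL1.le hleft Set.subset_union_left (Or.inl (sol.hbc0 t ht0))
    (by simp)
  have hest2 := hest S.L2 S.L3 S.hL23.le hright Set.subset_union_right
    (Or.inr (sol.hbcL3 t ht0)) (le_max_right _ _)
  refine ⟨_, ((hderiv 0 S.L1 S.hL1.le hleft).add (hderiv S.L2 S.L3 S.hL23.le hright)).add
    (hasDerivAt_integral_mul_deriv S.hL12.le ht sol.hvcont sol.hvtcont sol.hvttcont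
      sol.hvt sol.hvtt), ?_⟩
  have hboundary : S.a * (sol.u S.L1 t * sol.ux S.L1 t - sol.u 0 t * sol.ux 0 t)
      + S.a * (sol.u S.L3 t * sol.ux S.L3 t - sol.u S.L2 t * sol.ux S.L2 t)
      + S.b * (sol.v S.L2 t * sol.vx S.L2 t - sol.v S.L1 t * sol.vx S.L1 t) = 0 := by
    rw [sol.hbc0 t ht0, sol.hbcL3 t ht0, ← sol.htrans1 t ht0, ← sol.htrans2 t ht0]
    linear_combination sol.u S.L1 t * sol.htrans3 t ht0 - sol.u S.L2 t * sol.htrans4 t ht0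
  rw [hv]
  linarith
end
end

section
/- (Lemma 4.2, second identity) Let (u,v,z) be a classical solution of the transmission system, let q be the piecewise function q(x) = x − L₁/2 on [0,L₁], q(x) = ((L₂−L₃−L₁)/(2(L₂−L₁)))(x − L₁) + L₁/2 on [L₁,L₂], q(x) = x − (L₂+L₃)/2 on [L₂,L₃], and set I₃(t) = −∫_{L₁}^{L₂} q(x) v_x v_t dx. Then for every t > 0, d/dt I₃(t) = ((L₂−L₃−L₁)/(4(L₂−L₁))) ( ∫_{L₁}^{L₂} v_t² dx + b ∫_{L₁}^{L₂} v_x² dx ) + (1/4)[ L₁ v_t(L₁,t)² + (L₃−L₂) v_t(L₂,t)² ] + (b/4)[ L₁ v_x(L₁,t)² + (L₃−L₂) v_x(L₂,t)² ]. -/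
open Set Real MeasureTheory intervalIntegral

noncomputable section

/-- The piecewise multiplier `q`. -/
def qfun (L1 L2 L3 x : ℝ) : ℝ :=
  if x ≤ L1 then x - L1 / 2
  else if x ≤ L2 then (L2 - L3 - L1) / (2 * (L2 - L1)) * (x - L1) + L1 / 2
  else x - (L2 + L3) / 2

/-- Integration by parts for `(k x + m) f f'`. -/
theorem integral_affine_mul_mul_deriv {a b k m : ℝ} {f f' : ℝ → ℝ} (hab : a ≤ b)
    (hf : ∀ x ∈ Icc a b, HasDerivAt f (f' x) x) (hf' : ContinuousOn f' (Icc a b)) :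
    ∫ x in a..b, (k * x + m) * f' x * f x =
      ((k * b + m) * f b ^ 2 - (k * a + m) * f a ^ 2) / 2 - k / 2 * ∫ x in a..b, f x ^ 2 := by
  have hfc : ContinuousOn f (Icc a b) := fun x hx => (hf x hx).continuousAt.continuousWithinAt
  have hderiv : ∀ x ∈ uIcc a b, HasDerivAt (fun y => (k * y + m) * f y ^ 2 / 2)
      ((k * x + m) * f' x * f x + k / 2 * f x ^ 2) x := by
    intro x hx
    rw [uIcc_of_le hab] at hx
    have hq : HasDerivAt (fun y => k * y + m) k x := by
      simpa using ((hasDerivAt_id x).const_mul k).add_const m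
    refine ((hq.mul ((hf x hx).pow 2)).div_const 2).congr_deriv ?_
    simp only [Pi.pow_apply]
    ring
  have hint₁ : IntervalIntegrable (fun x => (k * x + m) * f' x * f x) volume a b :=
    ContinuousOn.intervalIntegrable_of_Icc hab (by fun_prop)
  have hint₂ : IntervalIntegrable (fun x => k / 2 * f x ^ 2) volume a b :=
    ContinuousOn.intervalIntegrable_of_Icc hab (by fun_prop)
  have h := integral_eq_sub_of_hasDerivAt hderiv (hint₁.add hint₂)
  rw [integral_add hint₁ hint₂, intervalIntegral.integral_const_mul] at h
  linarith

/-- Derivative in time of `∫ (k x + m) v_x v_t`, without any assumption on the mixed derivative of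
`v`. -/
theorem hasDerivAt_integral_affine_mul_mul {a b k m t ε : ℝ} {v vx vt vtt : ℝ → ℝ → ℝ}
    (hab : a ≤ b) (hε : 0 < ε)
    (hvx : ∀ x ∈ Icc a b, ∀ s ∈ Icc (t - ε) (t + ε), HasDerivAt (fun y => v y s) (vx x s) x)
    (hvt : ∀ x ∈ Icc a b, ∀ s ∈ Icc (t - ε) (t + ε), HasDerivAt (fun r => v x r) (vt x s) s)
    (hvtt : ∀ x ∈ Icc a b, ∀ s ∈ Icc (t - ε) (t + ε), HasDerivAt (fun r => vt x r) (vtt x s) s)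
    (hvxc : ContinuousOn (Function.uncurry vx) (Icc a b ×ˢ Icc (t - ε) (t + ε)))
    (hvtc : ContinuousOn (Function.uncurry vt) (Icc a b ×ˢ Icc (t - ε) (t + ε)))
    (hvttc : ContinuousOn (Function.uncurry vtt) (Icc a b ×ˢ Icc (t - ε) (t + ε))) :
    HasDerivAt (fun s => ∫ x in a..b, (k * x + m) * vx x s * vt x s)
      (((k * b + m) * vt b t ^ 2 - (k * a + m) * vt a t ^ 2) / 2 - k / 2 * (∫ x in a..b, vt x t ^ 2)
        + ∫ x in a..b, (k * x + m) * vx x t * vtt x t) t := by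
  set J := Icc (t - ε) (t + ε) with hJ
  have htJ : t ∈ J := ⟨by linarith, by linarith⟩
  have hJt : J ∈ nhds t := Icc_mem_nhds (by linarith) (by linarith)
  have hJev : ∀ᶠ s in nhdsWithin t {t}ᶜ, s ∈ J ∧ s ≠ t :=
    Filter.Eventually.and (mem_nhdsWithin_of_mem_nhds hJt) self_mem_nhdsWithin
  have hslice : ∀ {g : ℝ → ℝ → ℝ}, ContinuousOn (Function.uncurry g) (Icc a b ×ˢ J) →
      ∀ s ∈ J, ContinuousOn (fun x => g x s) (Icc a b) := fun hg s hs =>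
    hg.comp (f := fun x => (x, s)) (by fun_prop) fun x hx => ⟨hx, hs⟩
  have hvc : ∀ s ∈ J, ContinuousOn (fun x => v x s) (Icc a b) := fun s hs x hx =>
    (hvx x hx s hs).continuousAt.continuousWithinAt
  have hK : IsCompact (Icc a b ×ˢ J) := isCompact_Icc.prod isCompact_Icc
  obtain ⟨Cx, hCx⟩ := hK.exists_bound_of_continuousOn hvxc
  obtain ⟨Ct, hCt⟩ := hK.exists_bound_of_continuousOn hvtc
  obtain ⟨Ctt, hCtt⟩ := hK.exists_bound_of_continuousOn hvttc
  obtain ⟨Cq, hCq⟩ := (isCompact_Icc (a := a) (b := b)).exists_bound_of_continuousOn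
    (f := fun x => k * x + m) (by fun_prop)
  have hmemK : ∀ {x s}, x ∈ Icc a b → s ∈ J → (x, s) ∈ Icc a b ×ˢ J := fun hx hs => ⟨hx, hs⟩
  have hCx' : ∀ x ∈ Icc a b, ∀ s ∈ J, |vx x s| ≤ Cx := fun x hx s hs => hCx _ (hmemK hx hs)
  have hCt' : ∀ x ∈ Icc a b, ∀ s ∈ J, |vt x s| ≤ Ct := fun x hx s hs => hCt _ (hmemK hx hs)
  have hCtt' : ∀ x ∈ Icc a b, ∀ s ∈ J, |vtt x s| ≤ Ctt := fun x hx s hs => hCtt _ (hmemK hx hs)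
  have hCq' : ∀ x ∈ Icc a b, |k * x + m| ≤ Cq := hCq
  have haI : a ∈ Icc a b := left_mem_Icc.2 hab
  have hbI : b ∈ Icc a b := right_mem_Icc.2 hab
  have hCx0 : 0 ≤ Cx := (abs_nonneg _).trans (hCx' a haI t htJ)
  have hCtt0 : 0 ≤ Ctt := (abs_nonneg _).trans (hCtt' a haI t htJ)
  have hCq0 : 0 ≤ Cq := (abs_nonneg _).trans (hCq' a haI)
  have hconvJ : Convex ℝ J := convex_Icc _ _
  -- difference quotients in time of `v` and `v_t`
  have hw_lim : ∀ x ∈ Icc a b, Filter.Tendsto (fun s => (v x s - v x t) / (s - t))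
      (nhdsWithin t {t}ᶜ) (nhds (vt x t)) := fun x hx => by
    simpa [slope_fun_def_field] using (hasDerivAt_iff_tendsto_slope.1 (hvt x hx t htJ))
  have hwt_lim : ∀ x ∈ Icc a b, Filter.Tendsto (fun s => (vt x s - vt x t) / (s - t))
      (nhdsWithin t {t}ᶜ) (nhds (vtt x t)) := fun x hx => by
    simpa [slope_fun_def_field] using (hasDerivAt_iff_tendsto_slope.1 (hvtt x hx t htJ))
  have hvx_lim : ∀ x ∈ Icc a b, Filter.Tendsto (fun s => vx x s)
      (nhdsWithin t {t}ᶜ) (nhds (vx x t)) := fun x hx => by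
    have h : ContinuousOn (fun s => vx x s) J :=
      hvxc.comp (f := fun s => (x, s)) (by fun_prop) fun s hs => ⟨hx, hs⟩
    exact (h.continuousAt hJt).tendsto.mono_left nhdsWithin_le_nhds
  have hvt_lip : ∀ x ∈ Icc a b, ∀ r ∈ J, ∀ s ∈ J, |vt x s - vt x r| ≤ Ctt * |s - r| :=
    fun x hx r hr s hs => hconvJ.norm_image_sub_le_of_norm_hasDerivWithin_le
      (fun y hy => (hvtt x hx y hy).hasDerivWithinAt) (hCtt' x hx) hr hs
  have hw_bd : ∀ x ∈ Icc a b, ∀ s ∈ J, s ≠ t → |(v x s - v x t) / (s - t)| ≤ Ct :=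
    fun x hx s hs hst => by
      rw [abs_div, div_le_iff₀ (abs_pos.2 (sub_ne_zero.2 hst))]
      exact hconvJ.norm_image_sub_le_of_norm_hasDerivWithin_le
        (fun y hy => (hvt x hx y hy).hasDerivWithinAt) (hCt' x hx) htJ hs
  have hwt_bd : ∀ x ∈ Icc a b, ∀ s ∈ J, s ≠ t → |(vt x s - vt x t) / (s - t)| ≤ Ctt :=
    fun x hx s hs hst => by
      rw [abs_div, div_le_iff₀ (abs_pos.2 (sub_ne_zero.2 hst))]
      exact hvt_lip x hx t htJ s hs
  have herr_bd : ∀ x ∈ Icc a b, ∀ s ∈ J, s ≠ t →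
      |(vt x t - (v x s - v x t) / (s - t)) / (s - t)| ≤ Ctt := fun x hx s hs hst => by
    have hst' : s - t ≠ 0 := sub_ne_zero.2 hst
    have hsub : uIcc t s ⊆ J := by
      rw [hJ, ← uIcc_of_le (by linarith : t - ε ≤ t + ε)] at *
      exact uIcc_subset_uIcc htJ hs
    have h := (convex_uIcc t s).norm_image_sub_le_of_norm_hasDerivWithin_le
      (f := fun r => v x r - vt x t * r) (f' := fun r => vt x r - vt x t)
      (C := Ctt * |s - t|) (x := t) (y := s)
      (fun y hy =>
        ((hvt x hx y (hsub hy)).sub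
          (by simpa using (hasDerivAt_id y).const_mul (vt x t))).hasDerivWithinAt)
      (fun y hy => (hvt_lip x hx t htJ y (hsub hy)).trans
        (mul_le_mul_of_nonneg_left (abs_sub_left_of_mem_uIcc hy) hCtt0))
      left_mem_uIcc right_mem_uIcc
    have e : (vt x t - (v x s - v x t) / (s - t)) / (s - t) =
        -((v x s - vt x t * s - (v x t - vt x t * t)) / ((s - t) * (s - t))) := by
      field_simp
      ring
    rw [e, abs_neg, abs_div, abs_mul, div_le_iff₀ (by positivity), ← mul_assoc]
    exact h
  rw [hasDerivAt_iff_tendsto_slope]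
  have huI : ∀ {x}, x ∈ uIoc a b → x ∈ Icc a b := fun hx =>
    Ioc_subset_Icc_self (by rwa [uIoc_of_le hab] at hx)
  have hmeas : ∀ {g : ℝ → ℝ}, ContinuousOn g (Icc a b) →
      AEStronglyMeasurable g (volume.restrict (uIoc a b)) := fun hg => by
    rw [uIoc_of_le hab]
    exact (hg.mono Ioc_subset_Icc_self).aestronglyMeasurable measurableSet_Ioc
  have hlim_sq : Filter.Tendsto (fun s => ∫ x in a..b, ((v x s - v x t) / (s - t)) ^ 2)
      (nhdsWithin t {t}ᶜ) (nhds (∫ x in a..b, vt x t ^ 2)) := by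
    refine intervalIntegral.tendsto_integral_filter_of_dominated_convergence (fun _ => Ct ^ 2)
      ?_ ?_ (by simp) ?_
    · filter_upwards [hJev] with s hs
      have h₁ := hvc s hs.1
      have h₂ := hvc t htJ
      exact hmeas (by fun_prop)
    · filter_upwards [hJev] with s hs
      refine Filter.Eventually.of_forall fun x hx => ?_
      rw [Real.norm_eq_abs, abs_pow]
      exact pow_le_pow_left₀ (abs_nonneg _) (hw_bd x (huI hx) s hs.1 hs.2) 2
    · exact Filter.Eventually.of_forall fun x hx => (hw_lim x (huI hx)).pow 2
  have hlim_err : Filter.Tendsto (fun s => ∫ x in a..b, (k * x + m) * (vx x s - vx x t) *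
        ((vt x t - (v x s - v x t) / (s - t)) / (s - t)))
      (nhdsWithin t {t}ᶜ) (nhds (∫ _ in a..b, (0 : ℝ))) := by
    refine intervalIntegral.tendsto_integral_filter_of_dominated_convergence
      (fun _ => Cq * (Cx + Cx) * Ctt) ?_ ?_ (by simp) ?_
    · filter_upwards [hJev] with s hs
      have h₁ := hvc s hs.1
      have h₂ := hvc t htJ
      have h₃ := hslice hvxc s hs.1
      have h₄ := hslice hvxc t htJ
      have h₅ := hslice hvtc t htJ
      exact hmeas (by fun_prop)
    · filter_upwards [hJev] with s hs
      refine Filter.Eventually.of_forall fun x hx => ?_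
      rw [Real.norm_eq_abs, abs_mul, abs_mul]
      have := hCq' x (huI hx)
      have := herr_bd x (huI hx) s hs.1 hs.2
      have := (abs_sub (vx x s) (vx x t)).trans
        (add_le_add (hCx' x (huI hx) s hs.1) (hCx' x (huI hx) t htJ))
      gcongr
    · refine Filter.Eventually.of_forall fun x hx => ?_
      refine squeeze_zero_norm' (a := fun s => Cq * |vx x s - vx x t| * Ctt) ?_ ?_
      · filter_upwards [hJev] with s hs
        rw [Real.norm_eq_abs, abs_mul, abs_mul]
        have := hCq' x (huI hx)
        have := herr_bd x (huI hx) s hs.1 hs.2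
        gcongr
      · simpa using ((((hvx_lim x (huI hx)).sub_const (vx x t)).abs).const_mul Cq).mul_const Ctt
  have hlim_tt : Filter.Tendsto (fun s => ∫ x in a..b, (k * x + m) * vx x s *
        ((vt x s - vt x t) / (s - t)))
      (nhdsWithin t {t}ᶜ) (nhds (∫ x in a..b, (k * x + m) * vx x t * vtt x t)) := by
    refine intervalIntegral.tendsto_integral_filter_of_dominated_convergence
      (fun _ => Cq * Cx * Ctt) ?_ ?_ (by simp) ?_
    · filter_upwards [hJev] with s hs
      have h₃ := hslice hvxc s hs.1
      have h₄ := hslice hvtc s hs.1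
      have h₅ := hslice hvtc t htJ
      exact hmeas (by fun_prop)
    · filter_upwards [hJev] with s hs
      refine Filter.Eventually.of_forall fun x hx => ?_
      rw [Real.norm_eq_abs, abs_mul, abs_mul]
      have := hCq' x (huI hx)
      have := hwt_bd x (huI hx) s hs.1 hs.2
      have := hCx' x (huI hx) s hs.1
      gcongr
    · exact Filter.Eventually.of_forall fun x hx =>
        ((hvx_lim x (huI hx)).const_mul _).mul (hwt_lim x (huI hx))
  have hlim := ((((((hw_lim b hbI).pow 2).const_mul (k * b + m)).sub
    (((hw_lim a haI).pow 2).const_mul (k * a + m))).div_const 2).sub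
      (hlim_sq.const_mul (k / 2))).add (hlim_err.add hlim_tt)
  rw [intervalIntegral.integral_zero, zero_add] at hlim
  refine hlim.congr' ?_
  filter_upwards [hJev] with s hs
  have hst : s - t ≠ 0 := sub_ne_zero.2 hs.2
  have h₁ := hvc s hs.1
  have h₂ := hvc t htJ
  have h₃ := hslice hvxc s hs.1
  have h₄ := hslice hvxc t htJ
  have h₅ := hslice hvtc s hs.1
  have h₆ := hslice hvtc t htJ
  have hparts := integral_affine_mul_mul_deriv (k := k) (m := m) hab
    (f := fun x => (v x s - v x t) / (s - t)) (f' := fun x => (vx x s - vx x t) / (s - t))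
    (fun x hx => ((hvx x hx s hs.1).sub (hvx x hx t htJ)).div_const _) (by fun_prop)
  rw [← hparts, slope_def_field,
    ← integral_sub (ContinuousOn.intervalIntegrable_of_Icc hab (by fun_prop))
      (ContinuousOn.intervalIntegrable_of_Icc hab (by fun_prop)),
    ← integral_add (ContinuousOn.intervalIntegrable_of_Icc hab (by fun_prop))
      (ContinuousOn.intervalIntegrable_of_Icc hab (by fun_prop)),
    ← integral_add (ContinuousOn.intervalIntegrable_of_Icc hab (by fun_prop))
      (ContinuousOn.intervalIntegrable_of_Icc hab (by fun_prop)),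
    ← intervalIntegral.integral_div]
  refine intervalIntegral.integral_congr fun x _ => ?_
  field_simp
  ring

theorem qfun_eq_affine {L1 L2 L3 x : ℝ} (hx : x ∈ Icc L1 L2) :
    qfun L1 L2 L3 x = (L2 - L3 - L1) / (2 * (L2 - L1)) * x +
      (L1 / 2 - (L2 - L3 - L1) / (2 * (L2 - L1)) * L1) := by
  unfold qfun
  rcases hx.1.eq_or_lt with rfl | h
  · simp
    ring
  · rw [if_neg h.not_ge, if_pos hx.2]
    ring

/-- Lemma 4.2, second identity: the derivative identity for
`I₃(t) = −∫_{L₁}^{L₂} q(x) v_x v_t dx`. -/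
theorem I3_identity (S : TransmissionSystem) (sol : Solution S) :
    ∀ t ∈ Set.Ioi (0:ℝ),
      HasDerivAt (fun s : ℝ =>
        -∫ x in S.L1..S.L2, qfun S.L1 S.L2 S.L3 x * sol.vx x s * sol.vt x s)
        ((S.L2 - S.L3 - S.L1) / (4 * (S.L2 - S.L1)) *
            ((∫ x in S.L1..S.L2, (sol.vt x t)^2)
              + S.b * ∫ x in S.L1..S.L2, (sol.vx x t)^2)
          + (1/4) * (S.L1 * (sol.vt S.L1 t)^2 + (S.L3 - S.L2) * (sol.vt S.L2 t)^2)
          + (S.b / 4) * (S.L1 * (sol.vx S.L1 t)^2 + (S.L3 - S.L2) * (sol.vx S.L2 t)^2)) t := by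
  intro t ht
  have ht : 0 < t := ht
  have h12 := S.hL12
  have hne : S.L2 - S.L1 ≠ 0 := sub_ne_zero.2 h12.ne'
  have hJ : Icc (t - t / 2) (t + t / 2) ⊆ Ici 0 := fun s hs => by
    have := hs.1
    simp only [mem_Ici]
    linarith
  have ht0 : t ∈ Ici (0 : ℝ) := ht.le
  have hK : Icc S.L1 S.L2 ×ˢ Icc (t - t / 2) (t + t / 2) ⊆ Icc S.L1 S.L2 ×ˢ Ici 0 :=
    prod_mono subset_rfl hJ
  set k := (S.L2 - S.L3 - S.L1) / (2 * (S.L2 - S.L1)) with hk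
  set m := S.L1 / 2 - k * S.L1 with hm
  have hderiv := (hasDerivAt_integral_affine_mul_mul (k := k) (m := m) h12.le (half_pos ht)
    (fun x hx s hs => sol.hvx x hx s (hJ hs)) (fun x hx s hs => sol.hvt x hx s (hJ hs))
    (fun x hx s hs => sol.hvtt x hx s (hJ hs)) (sol.hvxcont.mono hK) (sol.hvtcont.mono hK)
    (sol.hvttcont.mono hK)).neg
  have hwave : ∫ x in S.L1..S.L2, (k * x + m) * sol.vx x t * sol.vtt x t =
      S.b * ∫ x in S.L1..S.L2, (k * x + m) * sol.vxx x t * sol.vx x t := by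
    rw [← intervalIntegral.integral_const_mul]
    refine intervalIntegral.integral_congr_ae ?_
    filter_upwards [Measure.ae_ne volume S.L2] with x hx2 hx
    rw [uIoc_of_le h12.le] at hx
    rw [sol.hveq x ⟨hx.1, lt_of_le_of_ne hx.2 hx2⟩ t ht]
    ring
  have hparts := integral_affine_mul_mul_deriv (k := k) (m := m) h12.le
    (fun x hx => sol.hvxx x hx t ht0)
    (sol.hvxxcont.comp (f := fun x => (x, t)) (by fun_prop) fun x hx => ⟨hx, ht0⟩)
  have hq1 : k * S.L1 + m = S.L1 / 2 := by
    rw [hm]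
    ring
  have hq2 : k * S.L2 + m = (S.L2 - S.L3) / 2 := by
    rw [hm, hk]
    field_simp
    ring
  have hk' : (S.L2 - S.L3 - S.L1) / (4 * (S.L2 - S.L1)) = k / 2 := by
    rw [hk]
    field_simp
    norm_num
  rw [hwave, hparts, hq1, hq2] at hderiv
  rw [hk']
  refine (hderiv.congr_deriv (by ring)).congr_of_eventuallyEq
    (Filter.Eventually.of_forall fun s => ?_)
  refine congrArg Neg.neg (intervalIntegral.integral_congr fun x hx => ?_)
  rw [uIcc_of_le h12.le] at hx
  simp only [qfun_eq_affine hx, hm, hk]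
end
end

section
/- (Lemma 4.3) Let (u,v,z) be a classical solution of the transmission system and define J(t) = ξ̄ τ(t) ∫_Ω ∫₀¹ e^{−2τ(t)ρ} z(x,ρ,t)² dρ dx. Then for every t > 0, d/dt J(t) ≤ −2 J(t) + ξ̄ ∫_Ω u_t(x,t)² dx. -/
open Set Real MeasureTheory intervalIntegral

noncomputable section

/-- Differentiation under the integral sign over a compact set, for an integrand that is
continuous together with its derivative in the parameter. -/
theorem hasDerivAt_setIntegral_of_continuousOn {X : Type*} [TopologicalSpace X]
    [MeasurableSpace X] [OpensMeasurableSpace X] {μ : Measure X} [IsFiniteMeasureOnCompacts μ]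
    {K : Set X} (hK : IsCompact K) (hKm : MeasurableSet K) {f f' : X → ℝ → ℝ} {t ε : ℝ}
    (hε : 0 < ε)
    (hf : ContinuousOn (Function.uncurry f) (K ×ˢ Icc (t - ε) (t + ε)))
    (hf' : ContinuousOn (Function.uncurry f') (K ×ˢ Icc (t - ε) (t + ε)))
    (hd : ∀ x ∈ K, ∀ s ∈ Icc (t - ε) (t + ε), HasDerivAt (f x) (f' x s) s) :
    HasDerivAt (fun s => ∫ x in K, f x s ∂μ) (∫ x in K, f' x t ∂μ) t := by
  have ht : t ∈ Icc (t - ε) (t + ε) := ⟨by linarith, by linarith⟩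
  have hnhds : Icc (t - ε) (t + ε) ∈ nhds t := Icc_mem_nhds (by linarith) (by linarith)
  have slice : ∀ {g : X → ℝ → ℝ},
      ContinuousOn (Function.uncurry g) (K ×ˢ Icc (t - ε) (t + ε)) →
      ∀ s ∈ Icc (t - ε) (t + ε), ContinuousOn (fun x => g x s) K := fun hg s hs =>
    hg.comp (f := fun x => (x, s)) (by fun_prop) fun x hx => ⟨hx, hs⟩
  obtain ⟨C, hC⟩ := (hK.prod isCompact_Icc).exists_bound_of_continuousOn hf'
  refine (hasDerivAt_integral_of_dominated_loc_of_deriv_le (F := fun s x => f x s)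
    (F' := fun s x => f' x s) (bound := fun _ => C) hnhds ?_ ?_ ?_ ?_ ?_ ?_).2
  · filter_upwards [hnhds] with s hs
    exact ((slice hf s hs).integrableOn_compact' hK hKm).aestronglyMeasurable
  · exact (slice hf t ht).integrableOn_compact' hK hKm
  · exact ((slice hf' t ht).integrableOn_compact' hK hKm).aestronglyMeasurable
  · filter_upwards [ae_restrict_mem hKm] with x hx s hs
    exact hC (x, s) ⟨hx, hs⟩
  · exact continuousOn_const.integrableOn_compact' hK hKm
  · filter_upwards [ae_restrict_mem hKm] with x hx s hs
    exact hd x hx s hs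

/-- Iterated interval integrals agree with the integral over the closed rectangle. -/
theorem setIntegral_Icc_prod_Icc {p q c e : ℝ} (hpq : p ≤ q) (hce : c ≤ e) {g : ℝ → ℝ → ℝ}
    (hg : IntegrableOn (fun w : ℝ × ℝ => g w.1 w.2) (Icc p q ×ˢ Icc c e)) :
    ∫ w in Icc p q ×ˢ Icc c e, g w.1 w.2 = ∫ x in p..q, ∫ ρ in c..e, g x ρ := by
  rw [Measure.volume_eq_prod] at hg ⊢
  rw [setIntegral_prod _ hg]
  simp only [integral_of_le hpq, integral_of_le hce, integral_Icc_eq_integral_Ioc]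

/-- The inner integral of a function integrable on a rectangle is interval integrable. -/
theorem intervalIntegrable_integral_of_integrableOn_prod {p q c e : ℝ} (hpq : p ≤ q)
    (hce : c ≤ e) {g : ℝ → ℝ → ℝ}
    (hg : IntegrableOn (fun w : ℝ × ℝ => g w.1 w.2) (Icc p q ×ˢ Icc c e)) :
    IntervalIntegrable (fun x => ∫ ρ in c..e, g x ρ) volume p q := by
  rw [intervalIntegrable_iff_integrableOn_Icc_of_le hpq]
  rw [IntegrableOn, Measure.volume_eq_prod, ← Measure.prod_restrict] at hg
  have h := hg.integral_prod_left
  simp only [integral_Icc_eq_integral_Ioc] at h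
  simpa only [IntegrableOn, integral_of_le hce] using h

/-- For a solution of the delay transport equation, the time derivative of
`∫ τ e^{-2τρ} z² dρ` at a fixed space point is controlled by the trace of `z` at `ρ = 0`. -/
theorem integral_weighted_sq_deriv_le {τ τ' : ℝ} (hτ' : τ' ≤ 1) {z zρ zt : ℝ → ℝ}
    (hz : ∀ ρ ∈ Icc (0:ℝ) 1, HasDerivAt z (zρ ρ) ρ)
    (hzt : ContinuousOn zt (Icc 0 1))
    (heq : ∀ ρ ∈ Ioo (0:ℝ) 1, τ * zt ρ + (1 - τ' * ρ) * zρ ρ = 0) :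
    ∫ ρ in (0:ℝ)..1, (τ' * (exp (-2 * τ * ρ) * z ρ ^ 2) +
        τ * (exp (-2 * τ * ρ) * (-2 * τ' * ρ) * z ρ ^ 2 +
          exp (-2 * τ * ρ) * (2 * z ρ * zt ρ)))
      ≤ -2 * (τ * ∫ ρ in (0:ℝ)..1, exp (-2 * τ * ρ) * z ρ ^ 2) + z 0 ^ 2 := by
  have hzc : ContinuousOn z (Icc 0 1) := fun ρ hρ => (hz ρ hρ).continuousAt.continuousWithinAt
  set g : ℝ → ℝ := fun ρ => τ' * (exp (-2 * τ * ρ) * z ρ ^ 2) +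
        τ * (exp (-2 * τ * ρ) * (-2 * τ' * ρ) * z ρ ^ 2 +
          exp (-2 * τ * ρ) * (2 * z ρ * zt ρ)) with hg
  have hgi : IntervalIntegrable g volume 0 1 :=
    ContinuousOn.intervalIntegrable_of_Icc zero_le_one (by fun_prop)
  have hei : IntervalIntegrable (fun ρ => exp (-2 * τ * ρ) * z ρ ^ 2) volume 0 1 :=
    ContinuousOn.intervalIntegrable_of_Icc zero_le_one (by fun_prop)
  have hFTC := integral_eq_sub_of_hasDerivAt_of_le (zero_le_one' ℝ)
    (f := fun ρ => exp (-2 * τ * ρ) * (1 - τ' * ρ) * z ρ ^ 2)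
    (f' := fun ρ => (-2 * τ) * (exp (-2 * τ * ρ) * z ρ ^ 2) - g ρ)
    (by fun_prop) ?_ ((hei.const_mul _).sub hgi)
  · rw [integral_sub (hei.const_mul _) hgi, intervalIntegral.integral_const_mul] at hFTC
    have h1 : 0 ≤ exp (-2 * τ * 1) * (1 - τ' * 1) * z 1 ^ 2 := by
      have : 0 ≤ 1 - τ' * 1 := by linarith
      positivity
    simp only [mul_zero, exp_zero, sub_zero, one_mul] at hFTC
    linarith
  · intro ρ hρ
    have he : HasDerivAt (fun ρ => exp (-2 * τ * ρ)) (exp (-2 * τ * ρ) * (-2 * τ)) ρ := by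
      simpa using ((hasDerivAt_id ρ).const_mul (-2 * τ)).exp
    have hl : HasDerivAt (fun ρ => 1 - τ' * ρ) (-τ') ρ := by
      simpa using ((hasDerivAt_id ρ).const_mul τ').const_sub 1
    refine ((he.mul hl).mul ((hz ρ (Ioo_subset_Icc_self hρ)).pow 2)).congr_deriv ?_
    simp only [hg, Pi.mul_apply, Pi.pow_apply]
    push_cast
    linear_combination (2 * exp (-2 * τ * ρ) * z ρ) * heq ρ hρ

/-- The estimate for `τ(t) ∫∫ e^{-2τ(t)ρ} z² dρ dx` on a single component `[p, q]` of the
damped region. -/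
theorem Solution.exists_hasDerivAt_delay_energy_le {S : TransmissionSystem} (sol : Solution S)
    {p q : ℝ} (hpq : p ≤ q) (hc : Icc p q ⊆ Omegac S.L1 S.L2 S.L3)
    (ho : Ioo p q ⊆ Omegao S.L1 S.L2 S.L3) {t : ℝ} (ht : 0 < t) :
    ∃ D : ℝ, HasDerivAt (fun s => S.τ s * ∫ x in p..q, ∫ ρ in (0:ℝ)..1,
        exp (-2 * S.τ s * ρ) * (sol.z x ρ s) ^ 2) D t ∧
      D ≤ -2 * (S.τ t * ∫ x in p..q, ∫ ρ in (0:ℝ)..1,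
        exp (-2 * S.τ t * ρ) * (sol.z x ρ t) ^ 2) + ∫ x in p..q, (sol.ut x t) ^ 2 := by
  set K : Set (ℝ × ℝ) := Icc p q ×ˢ Icc 0 1 with hKdef
  have hK : IsCompact K := isCompact_Icc.prod isCompact_Icc
  have hKm : MeasurableSet K := measurableSet_Icc.prod measurableSet_Icc
  have hε : 0 < t / 2 := by linarith
  set I : Set ℝ := Icc (t - t / 2) (t + t / 2) with hI
  have hI0 : ∀ s ∈ I, s ∈ Ici (0:ℝ) := fun s hs => mem_Ici.2 (by linarith [hs.1])
  have htI : t ∈ I := ⟨by linarith, by linarith⟩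
  have hmaps : MapsTo (fun w : (ℝ × ℝ) × ℝ => (w.1.1, w.1.2, w.2)) (K ×ˢ I)
      (Omegac S.L1 S.L2 S.L3 ×ˢ (Icc 0 1 ×ˢ Ici 0)) :=
    fun w hw => ⟨hc hw.1.1, hw.1.2, hI0 _ hw.2⟩
  have hzc : ContinuousOn (fun w : (ℝ × ℝ) × ℝ => sol.z w.1.1 w.1.2 w.2) (K ×ˢ I) :=
    sol.hzcont.comp (by fun_prop) hmaps
  have hztc : ContinuousOn (fun w : (ℝ × ℝ) × ℝ => sol.zt w.1.1 w.1.2 w.2) (K ×ˢ I) :=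
    sol.hztcont.comp (by fun_prop) hmaps
  have hτc : ContinuousOn (fun w : (ℝ × ℝ) × ℝ => S.τ w.2) (K ×ˢ I) :=
    ContinuousOn.comp (g := S.τ) (t := I)
      (fun s hs => (S.hτderiv s (hI0 s hs)).continuousAt.continuousWithinAt)
      continuousOn_snd fun w hw => hw.2
  have hτ'c : ContinuousOn (fun w : (ℝ × ℝ) × ℝ => S.τ' w.2) (K ×ˢ I) :=
    S.hτ'cont.comp continuousOn_snd fun w hw => hI0 _ hw.2
  set f : ℝ × ℝ → ℝ → ℝ := fun w s => exp (-2 * S.τ s * w.2) * (sol.z w.1 w.2 s) ^ 2 with hf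
  set f' : ℝ × ℝ → ℝ → ℝ := fun w s =>
    S.τ' s * f w s + S.τ s * (exp (-2 * S.τ s * w.2) * (-2 * S.τ' s * w.2) *
      (sol.z w.1 w.2 s) ^ 2 +
      exp (-2 * S.τ s * w.2) * (2 * sol.z w.1 w.2 s * sol.zt w.1 w.2 s)) with hf'
  have hfc : ContinuousOn (Function.uncurry f) (K ×ˢ I) := by
    simp only [hf, Function.uncurry_def]
    fun_prop
  have hf'c : ContinuousOn (Function.uncurry f') (K ×ˢ I) := by
    simp only [hf', hf, Function.uncurry_def]
    fun_prop
  have hint : ∀ {g : ℝ × ℝ → ℝ → ℝ}, ContinuousOn (Function.uncurry g) (K ×ˢ I) →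
      ∀ s ∈ I, IntegrableOn (fun w : ℝ × ℝ => g (w.1, w.2) s) K := fun hg s hs =>
    (hg.comp (f := fun w : ℝ × ℝ => (w, s)) (by fun_prop)
      fun w hw => ⟨hw, hs⟩).integrableOn_compact' hK hKm
  have hderiv := hasDerivAt_setIntegral_of_continuousOn (μ := (volume : Measure (ℝ × ℝ)))
    hK hKm (f := fun w s => S.τ s * f w s) (f' := f') hε
    (by simp only [hf, Function.uncurry_def]; fun_prop) hf'c ?_
  · refine ⟨_, hderiv.congr_of_eventuallyEq ?_, ?_⟩
    · filter_upwards [Icc_mem_nhds (a := t - t / 2) (b := t + t / 2) (by linarith)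
        (by linarith)] with s hs
      rw [MeasureTheory.integral_const_mul, ← setIntegral_Icc_prod_Icc hpq zero_le_one (hint hfc s hs)]
    · have hut : ContinuousOn (fun x => sol.ut x t) (Icc p q) :=
        sol.hutcont.comp (f := fun x => (x, t)) (by fun_prop) fun x hx => ⟨hc hx, ht.le⟩
      have huti : IntervalIntegrable (fun x => sol.ut x t ^ 2) volume p q :=
        ContinuousOn.intervalIntegrable_of_Icc hpq (hut.pow 2)
      have hfi := intervalIntegrable_integral_of_integrableOn_prod hpq zero_le_one
        (g := fun x ρ => f (x, ρ) t) (hint hfc t htI)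
      have hf'i := intervalIntegrable_integral_of_integrableOn_prod hpq zero_le_one
        (g := fun x ρ => f' (x, ρ) t) (hint hf'c t htI)
      rw [← intervalIntegral.integral_const_mul, ← intervalIntegral.integral_const_mul,
        ← integral_add ((hfi.const_mul _).const_mul _) huti]
      refine (setIntegral_Icc_prod_Icc hpq zero_le_one (g := fun x ρ => f' (x, ρ) t)
        (hint hf'c t htI)).trans_le ?_
      refine integral_mono_on_of_le_Ioo hpq hf'i
        (((hfi.const_mul _).const_mul _).add huti) fun x hx => ?_
      have hxc := hc (Ioo_subset_Icc_self hx)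
      rw [← sol.hz0 x hxc t ht.le]
      exact integral_weighted_sq_deriv_le ((S.hτ'le t ht.le).trans S.hd.le)
        (fun ρ hρ => sol.hzρ x hxc ρ hρ t ht.le)
        (sol.hztcont.comp (f := fun ρ => (x, ρ, t)) (by fun_prop) fun ρ hρ => ⟨hxc, hρ, ht.le⟩)
        (fun ρ hρ => sol.hzeq x (ho hx) ρ hρ t ht)
  · intro w hw s hs
    have hτ := S.hτderiv s (hI0 s hs)
    have he : HasDerivAt (fun s => exp (-2 * S.τ s * w.2))
        (exp (-2 * S.τ s * w.2) * (-2 * S.τ' s * w.2)) s :=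
      ((hτ.const_mul (-2)).mul_const w.2).exp
    have hz := (sol.hzt w.1 (hc hw.1) w.2 hw.2 s (hI0 s hs)).pow 2
    refine (hτ.mul (he.mul hz)).congr_deriv ?_
    simp only [hf', hf, Pi.mul_apply, Pi.pow_apply]
    push_cast
    ring

/-- Lemma 4.3: the estimate for
`J(t) = ξ̄ τ(t) ∫_Ω ∫₀¹ e^{−2τ(t)ρ} z(x,ρ,t)² dρ dx`. -/
theorem J_estimate (S : TransmissionSystem) (sol : Solution S)
    (ξb : ℝ) (hξb1 : S.β / Real.sqrt (1 - S.d) < ξb)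
    (hξb2 : ξb < 2 - S.β / Real.sqrt (1 - S.d)) :
    ∀ t ∈ Set.Ioi (0:ℝ), ∃ D : ℝ,
      HasDerivAt (fun s : ℝ =>
        ξb * S.τ s *
          ((∫ x in (0:ℝ)..S.L1, ∫ ρ in (0:ℝ)..1,
              Real.exp (-2 * S.τ s * ρ) * (sol.z x ρ s)^2)
            + ∫ x in S.L2..S.L3, ∫ ρ in (0:ℝ)..1,
              Real.exp (-2 * S.τ s * ρ) * (sol.z x ρ s)^2)) D t ∧
      D ≤ -2 * (ξb * S.τ t *
            ((∫ x in (0:ℝ)..S.L1, ∫ ρ in (0:ℝ)..1,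
                Real.exp (-2 * S.τ t * ρ) * (sol.z x ρ t)^2)
              + ∫ x in S.L2..S.L3, ∫ ρ in (0:ℝ)..1,
                Real.exp (-2 * S.τ t * ρ) * (sol.z x ρ t)^2))
          + ξb * ((∫ x in (0:ℝ)..S.L1, (sol.ut x t)^2)
              + ∫ x in S.L2..S.L3, (sol.ut x t)^2) := by
  intro t ht
  obtain ⟨D₁, hD₁, hle₁⟩ := sol.exists_hasDerivAt_delay_energy_le S.hL1.le
    subset_union_left subset_union_left ht
  obtain ⟨D₂, hD₂, hle₂⟩ := sol.exists_hasDerivAt_delay_energy_le S.hL23.le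
    subset_union_right subset_union_right ht
  have hξ : 0 ≤ ξb := (div_nonneg S.hβpos.le (sqrt_nonneg _)).trans hξb1.le
  refine ⟨ξb * (D₁ + D₂), ((hD₁.add hD₂).const_mul ξb).congr_of_eventuallyEq ?_, ?_⟩
  · refine Filter.Eventually.of_forall fun s => ?_
    simp only [Pi.add_apply]
    ring
  · refine (mul_le_mul_of_nonneg_left (add_le_add hle₁ hle₂) hξ).trans_eq ?_
    ring
end
end

section
/- (Dissipativity of the shifted generator) Fix real numbers m₁ > 0, m₂ with |m₂| ≤ β m₁ where 0 < β < √(1−d), τ ∈ [τ₀, τ₁] with τ₀ > 0, δ ≤ d < 1, and ξ̄ with β/√(1−d) < ξ̄ < 2 − β/√(1−d), and set κ = √(1 + δ²)/(2τ). Let 0 < L₁ < L₂ < L₃, Ω = (0,L₁) ∪ (L₂,L₃), a, b > 0, and let u : Ω̄ → ℝ and v : [L₁,L₂] → ℝ be C², φ : Ω̄ → ℝ and ψ : [L₁,L₂] → ℝ be C¹, and z : Ω̄ × [0,1] → ℝ be C¹, satisfying φ(0) = φ(L₃) = 0, φ(L_i) = ψ(L_i) and a u_x(L_i) = b v_x(L_i)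 for i = 1,2, and z(x,0) = φ(x) for x ∈ Ω̄. Then ∫_Ω [ a u_xx φ − m₁ φ² − m₂ z(x,1) φ + a φ_x u_x ] dx + ∫_{L₁}^{L₂} [ b v_xx ψ + b ψ_x v_x ] dx − ξ̄ m₁ ∫_Ω ∫₀¹ (1 − δρ) z_ρ(x,ρ) z(x,ρ) dρ dx ≤ κ ( ∫_Ω φ² dx + a ∫_Ω u_x² dx + ∫_{L₁}^{L₂} ψ² dx + b ∫_{L₁}^{L₂} v_x² dx + ξ̄ m₁ τ ∫_Ω ∫₀¹ z(x,ρ)² dρ dx ). -/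
open MeasureTheory in
/-- Partial integrals of a continuous function on a closed rectangle are integrable. -/
theorem intervalIntegrable_partial_integral {p q r s : ℝ} (hpq : p ≤ q) (hrs : r ≤ s)
    {f : ℝ × ℝ → ℝ} (hf : ContinuousOn f (Set.Icc p q ×ˢ Set.Icc r s)) :
    IntervalIntegrable (fun x => ∫ y in r..s, f (x, y)) volume p q := by
  have h1 : IntegrableOn f (Set.Icc p q ×ˢ Set.Icc r s) (volume.prod volume) :=
    hf.integrableOn_compact (isCompact_Icc.prod isCompact_Icc)
  rw [IntegrableOn, ← Measure.prod_restrict] at h1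
  rw [intervalIntegrable_iff_integrableOn_Icc_of_le hpq, IntegrableOn]
  simpa only [intervalIntegral.integral_of_le hrs, integral_Icc_eq_integral_Ioc]
    using h1.integral_prod_left

/-- Integration by parts in the form: the integral of `(f g)'` is the boundary term. -/
theorem integral_mul_deriv_add_deriv_mul {p q c : ℝ} (hpq : p ≤ q) {f f' g g' : ℝ → ℝ}
    (hf : ∀ x ∈ Set.Icc p q, HasDerivAt f (f' x) x) (hf' : ContinuousOn f' (Set.Icc p q))
    (hg : ∀ x ∈ Set.Icc p q, HasDerivAt g (g' x) x) (hg' : ContinuousOn g' (Set.Icc p q)) :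
    ∫ x in p..q, (c * f' x * g x + c * g' x * f x) = c * f q * g q - c * f p * g p := by
  have hfc : ContinuousOn f (Set.Icc p q) :=
    fun x hx => (hf x hx).continuousAt.continuousWithinAt
  have hgc : ContinuousOn g (Set.Icc p q) :=
    fun x hx => (hg x hx).continuousAt.continuousWithinAt
  refine intervalIntegral.integral_eq_sub_of_hasDerivAt (f := fun x => c * f x * g x) ?_ ?_
  · intro x hx
    rw [Set.uIcc_of_le hpq] at hx
    exact (((hf x hx).const_mul c).mul (hg x hx)).congr_deriv (by ring)
  · refine ContinuousOn.intervalIntegrable_of_Icc hpq ?_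
    fun_prop

/-- Integration by parts in the delay variable. -/
theorem integral_delay_eq {δ : ℝ} {w w' : ℝ → ℝ}
    (hw : ∀ r ∈ Set.Icc (0 : ℝ) 1, HasDerivAt w (w' r) r)
    (hw' : ContinuousOn w' (Set.Icc 0 1)) :
    ∫ r in (0 : ℝ)..1, (1 - δ * r) * w' r * w r
      = ((1 - δ) * w 1 ^ 2 - w 0 ^ 2) / 2 + δ / 2 * ∫ r in (0 : ℝ)..1, w r ^ 2 := by
  have hwc : ContinuousOn w (Set.Icc 0 1) :=
    fun x hx => (hw x hx).continuousAt.continuousWithinAt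
  have hi1 : IntervalIntegrable (fun r => (1 - δ * r) * w' r * w r)
      MeasureTheory.volume 0 1 :=
    ContinuousOn.intervalIntegrable_of_Icc zero_le_one (by fun_prop)
  have hi2 : IntervalIntegrable (fun r => δ / 2 * w r ^ 2) MeasureTheory.volume 0 1 :=
    ContinuousOn.intervalIntegrable_of_Icc zero_le_one (by fun_prop)
  have key : ∫ r in (0 : ℝ)..1, ((1 - δ * r) * w' r * w r - δ / 2 * w r ^ 2)
      = (1 - δ * 1) / 2 * w 1 ^ 2 - (1 - δ * 0) / 2 * w 0 ^ 2 := by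
    refine intervalIntegral.integral_eq_sub_of_hasDerivAt
      (f := fun r => (1 - δ * r) / 2 * w r ^ 2) ?_ (hi1.sub hi2)
    intro r hr
    rw [Set.uIcc_of_le zero_le_one] at hr
    have h := ((((hasDerivAt_id r).const_mul δ).const_sub 1).div_const 2).mul ((hw r hr).pow 2)
    exact h.congr_deriv (by simp; ring)
  rw [intervalIntegral.integral_sub hi1 hi2, intervalIntegral.integral_const_mul] at key
  linarith

/-- The quadratic form in the values at the two ends of the delay interval is nonpositive. -/
theorem delay_quadratic_form_nonpos {m1 m2 β d δ ξ : ℝ} (hm1 : 0 < m1)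
    (hm2 : |m2| ≤ β * m1) (hδ : δ ≤ d) (hd : d < 1) (hβ0 : 0 < β)
    (hξ1 : β / Real.sqrt (1 - d) < ξ) (hξ2 : ξ < 2 - β / Real.sqrt (1 - d)) (f w : ℝ) :
    -m1 * f ^ 2 - m2 * w * f - ξ * m1 * (((1 - δ) * w ^ 2 - f ^ 2) / 2) ≤ 0 := by
  have hs : 0 < Real.sqrt (1 - d) := Real.sqrt_pos.2 (by linarith)
  have hs2 : Real.sqrt (1 - d) ^ 2 = 1 - d := Real.sq_sqrt (by linarith)
  generalize Real.sqrt (1 - d) = s at *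
  obtain ⟨k, hk⟩ : ∃ k, k = β / s := ⟨_, rfl⟩
  rw [← hk] at hξ1 hξ2
  have hβk : β = k * s := by rw [hk]; field_simp
  have hk0 : 0 < k := by rw [hk]; positivity
  subst hβk
  have h1 : -(m2 * w * f) ≤ k * s * m1 * (|w| * |f|) := by
    calc -(m2 * w * f) ≤ |m2 * w * f| := neg_le_abs _
      _ = |m2| * (|w| * |f|) := by rw [abs_mul, abs_mul, mul_assoc]
      _ ≤ _ := mul_le_mul_of_nonneg_right hm2 (by positivity)
  have h2 : s * (|w| * |f|) ≤ (f ^ 2 + s ^ 2 * w ^ 2) / 2 := by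
    nlinarith [sq_nonneg (|f| - s * |w|), sq_abs f, sq_abs w]
  have h3 : k * m1 * (s * (|w| * |f|)) ≤ k * m1 * ((f ^ 2 + s ^ 2 * w ^ 2) / 2) :=
    mul_le_mul_of_nonneg_left h2 (by positivity)
  have h4 : k * s ^ 2 ≤ ξ * (1 - δ) := by
    rw [hs2]
    exact mul_le_mul hξ1.le (by linarith) (by linarith) (by linarith)
  have h5 : 0 ≤ m1 * w ^ 2 * (ξ * (1 - δ) - k * s ^ 2) :=
    mul_nonneg (by positivity) (by linarith)
  have h6 : 0 ≤ m1 * f ^ 2 * (2 - k - ξ) := mul_nonneg (by positivity) (by linarith)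
  linarith

/-- Dissipation estimate on a single interval carrying the delay, with its boundary terms. -/
theorem delay_interval_dissipation {m1 m2 β d δ ξ a p q : ℝ} (hpq : p ≤ q) (hm1 : 0 < m1)
    (hm2 : |m2| ≤ β * m1) (hδ : δ ≤ d) (hd : d < 1) (hβ0 : 0 < β)
    (hξ1 : β / Real.sqrt (1 - d) < ξ) (hξ2 : ξ < 2 - β / Real.sqrt (1 - d))
    {ux uxx φ φx : ℝ → ℝ} {z zρ : ℝ → ℝ → ℝ}
    (huxx : ∀ x ∈ Set.Icc p q, HasDerivAt ux (uxx x) x)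
    (huxxcont : ContinuousOn uxx (Set.Icc p q))
    (hφx : ∀ x ∈ Set.Icc p q, HasDerivAt φ (φx x) x)
    (hφxcont : ContinuousOn φx (Set.Icc p q))
    (hzρ : ∀ x ∈ Set.Icc p q, ∀ ρ ∈ Set.Icc (0 : ℝ) 1,
      HasDerivAt (fun r => z x r) (zρ x ρ) ρ)
    (hzcont : ContinuousOn (fun y : ℝ × ℝ => z y.1 y.2) (Set.Icc p q ×ˢ Set.Icc 0 1))
    (hzρcont : ContinuousOn (fun y : ℝ × ℝ => zρ y.1 y.2) (Set.Icc p q ×ˢ Set.Icc 0 1))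
    (hz0 : ∀ x ∈ Set.Icc p q, z x 0 = φ x) :
    (∫ x in p..q, (a * uxx x * φ x - m1 * φ x ^ 2 - m2 * z x 1 * φ x + a * φx x * ux x))
      - ξ * m1 * (∫ x in p..q, ∫ ρ in (0 : ℝ)..1, (1 - δ * ρ) * zρ x ρ * z x ρ)
    ≤ a * ux q * φ q - a * ux p * φ p
      + ξ * m1 * (Real.sqrt (1 + δ ^ 2) / 2) *
        ∫ x in p..q, ∫ ρ in (0 : ℝ)..1, z x ρ ^ 2 := by
  have hξ : 0 < ξ := lt_of_le_of_lt (by positivity) hξ1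
  have huc : ContinuousOn ux (Set.Icc p q) :=
    fun x hx => (huxx x hx).continuousAt.continuousWithinAt
  have hφc : ContinuousOn φ (Set.Icc p q) :=
    fun x hx => (hφx x hx).continuousAt.continuousWithinAt
  have hz1c : ContinuousOn (fun x => z x 1) (Set.Icc p q) :=
    hzcont.comp (f := fun x : ℝ => (x, (1 : ℝ))) (by fun_prop)
      fun x hx => ⟨hx, Set.right_mem_Icc.2 zero_le_one⟩
  have hiA : IntervalIntegrable
      (fun x => a * uxx x * φ x - m1 * φ x ^ 2 - m2 * z x 1 * φ x + a * φx x * ux x)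
      MeasureTheory.volume p q :=
    ContinuousOn.intervalIntegrable_of_Icc hpq (by fun_prop)
  have hiB : IntervalIntegrable (fun x => a * uxx x * φ x + a * φx x * ux x)
      MeasureTheory.volume p q :=
    ContinuousOn.intervalIntegrable_of_Icc hpq (by fun_prop)
  have hiD : IntervalIntegrable (fun x => ∫ ρ in (0 : ℝ)..1, (1 - δ * ρ) * zρ x ρ * z x ρ)
      MeasureTheory.volume p q :=
    intervalIntegrable_partial_integral hpq zero_le_one
      (f := fun y => (1 - δ * y.2) * zρ y.1 y.2 * z y.1 y.2) (by fun_prop)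
  have hiZ : IntervalIntegrable (fun x => ∫ ρ in (0 : ℝ)..1, z x ρ ^ 2)
      MeasureTheory.volume p q :=
    intervalIntegrable_partial_integral hpq zero_le_one
      (f := fun y => z y.1 y.2 ^ 2) (by fun_prop)
  rw [← integral_mul_deriv_add_deriv_mul hpq huxx huxxcont hφx hφxcont,
    ← intervalIntegral.integral_const_mul, ← intervalIntegral.integral_const_mul,
    ← intervalIntegral.integral_sub hiA (hiD.const_mul _),
    ← intervalIntegral.integral_add hiB (hiZ.const_mul _)]
  refine intervalIntegral.integral_mono_on hpq (hiA.sub (hiD.const_mul _))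
    (hiB.add (hiZ.const_mul _)) fun x hx => ?_
  have hρc : ContinuousOn (fun ρ => zρ x ρ) (Set.Icc 0 1) :=
    hzρcont.comp (f := fun ρ : ℝ => (x, ρ)) (by fun_prop) fun ρ hρ => ⟨hx, hρ⟩
  have hdelay := integral_delay_eq (δ := δ) (hzρ x hx) hρc
  rw [hz0 x hx] at hdelay
  have hq := delay_quadratic_form_nonpos hm1 hm2 hδ hd hβ0 hξ1 hξ2 (φ x) (z x 1)
  have hZ : 0 ≤ ∫ ρ in (0 : ℝ)..1, z x ρ ^ 2 :=
    intervalIntegral.integral_nonneg zero_le_one fun ρ _ => sq_nonneg _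
  have hroot : -δ ≤ Real.sqrt (1 + δ ^ 2) :=
    Real.le_sqrt_of_sq_le (by nlinarith)
  have hfin : 0 ≤ ξ * m1 * (∫ ρ in (0 : ℝ)..1, z x ρ ^ 2) * (Real.sqrt (1 + δ ^ 2) + δ) :=
    mul_nonneg (by positivity) (by linarith)
  simp only [hdelay]
  linarith


/-- Dissipativity of the shifted generator: `⟨A(t)U, U⟩_t ≤ κ(t) ⟨U, U⟩_t`
with `κ = √(1 + δ²)/(2τ)`, for the delayed transmission system. -/
theorem shifted_generator_dissipative
    (m1 m2 β d τ0 τ1 τ δ ξb : ℝ)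
    (L1 L2 L3 a b : ℝ)
    (hm1 : 0 < m1) (hβ0 : 0 < β) (hβ : β < Real.sqrt (1 - d))
    (hm2 : |m2| ≤ β * m1)
    (hτ0 : 0 < τ0) (hττ0 : τ0 ≤ τ) (hττ1 : τ ≤ τ1)
    (hδ : δ ≤ d) (hd : d < 1)
    (hξb1 : β / Real.sqrt (1 - d) < ξb) (hξb2 : ξb < 2 - β / Real.sqrt (1 - d))
    (hL1 : 0 < L1) (hL12 : L1 < L2) (hL23 : L2 < L3)
    (ha : 0 < a) (hb : 0 < b)
    (u ux uxx φ φx : ℝ → ℝ)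
    (v vx vxx ψ ψx : ℝ → ℝ)
    (z zρ : ℝ → ℝ → ℝ)
    -- u is C² on Ω̄, φ is C¹ on Ω̄
    (hux : ∀ x ∈ Set.Icc 0 L1 ∪ Set.Icc L2 L3, HasDerivAt u (ux x) x)
    (huxx : ∀ x ∈ Set.Icc 0 L1 ∪ Set.Icc L2 L3, HasDerivAt ux (uxx x) x)
    (huxxcont : ContinuousOn uxx (Set.Icc 0 L1 ∪ Set.Icc L2 L3))
    (hφx : ∀ x ∈ Set.Icc 0 L1 ∪ Set.Icc L2 L3, HasDerivAt φ (φx x) x)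
    (hφxcont : ContinuousOn φx (Set.Icc 0 L1 ∪ Set.Icc L2 L3))
    -- v is C² on [L₁,L₂], ψ is C¹ on [L₁,L₂]
    (hvx : ∀ x ∈ Set.Icc L1 L2, HasDerivAt v (vx x) x)
    (hvxx : ∀ x ∈ Set.Icc L1 L2, HasDerivAt vx (vxx x) x)
    (hvxxcont : ContinuousOn vxx (Set.Icc L1 L2))
    (hψx : ∀ x ∈ Set.Icc L1 L2, HasDerivAt ψ (ψx x) x)
    (hψxcont : ContinuousOn ψx (Set.Icc L1 L2))
    -- z is C¹ on Ω̄ × [0,1]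
    (hzρ : ∀ x ∈ Set.Icc 0 L1 ∪ Set.Icc L2 L3, ∀ ρ ∈ Set.Icc (0:ℝ) 1,
      HasDerivAt (fun r => z x r) (zρ x ρ) ρ)
    (hzcont : ContinuousOn (fun p : ℝ × ℝ => z p.1 p.2)
      ((Set.Icc 0 L1 ∪ Set.Icc L2 L3) ×ˢ Set.Icc 0 1))
    (hzρcont : ContinuousOn (fun p : ℝ × ℝ => zρ p.1 p.2)
      ((Set.Icc 0 L1 ∪ Set.Icc L2 L3) ×ˢ Set.Icc 0 1))
    -- boundary, transmission and compatibility conditions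
    (hφ0 : φ 0 = 0) (hφL3 : φ L3 = 0)
    (hφψ1 : φ L1 = ψ L1) (hφψ2 : φ L2 = ψ L2)
    (htr1 : a * ux L1 = b * vx L1) (htr2 : a * ux L2 = b * vx L2)
    (hz0 : ∀ x ∈ Set.Icc 0 L1 ∪ Set.Icc L2 L3, z x 0 = φ x) :
    ((∫ x in (0:ℝ)..L1,
        a * uxx x * φ x - m1 * φ x ^ 2 - m2 * z x 1 * φ x + a * φx x * ux x)
      + ∫ x in L2..L3,
        a * uxx x * φ x - m1 * φ x ^ 2 - m2 * z x 1 * φ x + a * φx x * ux x)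
    + (∫ x in L1..L2, b * vxx x * ψ x + b * ψx x * vx x)
    - ξb * m1 * ((∫ x in (0:ℝ)..L1, ∫ ρ in (0:ℝ)..1, (1 - δ * ρ) * zρ x ρ * z x ρ)
      + ∫ x in L2..L3, ∫ ρ in (0:ℝ)..1, (1 - δ * ρ) * zρ x ρ * z x ρ)
    ≤ (Real.sqrt (1 + δ ^ 2) / (2 * τ)) *
      (((∫ x in (0:ℝ)..L1, φ x ^ 2) + ∫ x in L2..L3, φ x ^ 2)
        + a * ((∫ x in (0:ℝ)..L1, ux x ^ 2) + ∫ x in L2..L3, ux x ^ 2)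
        + (∫ x in L1..L2, ψ x ^ 2) + b * (∫ x in L1..L2, vx x ^ 2)
        + ξb * m1 * τ * ((∫ x in (0:ℝ)..L1, ∫ ρ in (0:ℝ)..1, z x ρ ^ 2)
          + ∫ x in L2..L3, ∫ ρ in (0:ℝ)..1, z x ρ ^ 2)) := by
  have hτ : 0 < τ := hτ0.trans_le hττ0
  have hξ : 0 < ξb := lt_of_le_of_lt (by positivity) hξb1
  have hsub1 : Set.Icc 0 L1 ⊆ Set.Icc 0 L1 ∪ Set.Icc L2 L3 := Set.subset_union_left
  have hsub2 : Set.Icc L2 L3 ⊆ Set.Icc 0 L1 ∪ Set.Icc L2 L3 := Set.subset_union_right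
  have hI1 := delay_interval_dissipation (a := a) hL1.le hm1 hm2 hδ hd hβ0 hξb1 hξb2
    (fun x hx => huxx x (hsub1 hx)) (huxxcont.mono hsub1)
    (fun x hx => hφx x (hsub1 hx)) (hφxcont.mono hsub1)
    (fun x hx => hzρ x (hsub1 hx)) (hzcont.mono (Set.prod_mono_left hsub1))
    (hzρcont.mono (Set.prod_mono_left hsub1)) (fun x hx => hz0 x (hsub1 hx))
  have hI2 := delay_interval_dissipation (a := a) hL23.le hm1 hm2 hδ hd hβ0 hξb1 hξb2
    (fun x hx => huxx x (hsub2 hx)) (huxxcont.mono hsub2)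
    (fun x hx => hφx x (hsub2 hx)) (hφxcont.mono hsub2)
    (fun x hx => hzρ x (hsub2 hx)) (hzcont.mono (Set.prod_mono_left hsub2))
    (hzρcont.mono (Set.prod_mono_left hsub2)) (fun x hx => hz0 x (hsub2 hx))
  have hJ := integral_mul_deriv_add_deriv_mul (c := b) hL12.le hvxx hvxxcont hψx hψxcont
  rw [hφ0, htr1, hφψ1] at hI1
  rw [hφL3, htr2, hφψ2] at hI2
  have hsq : ∀ (f : ℝ → ℝ) {p q : ℝ}, p ≤ q → 0 ≤ ∫ x in p..q, f x ^ 2 :=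
    fun f p q h => intervalIntegral.integral_nonneg h fun x _ => sq_nonneg _
  have hE : 0 ≤ (Real.sqrt (1 + δ ^ 2) / (2 * τ)) *
      (((∫ x in (0:ℝ)..L1, φ x ^ 2) + ∫ x in L2..L3, φ x ^ 2)
        + a * ((∫ x in (0:ℝ)..L1, ux x ^ 2) + ∫ x in L2..L3, ux x ^ 2)
        + (∫ x in L1..L2, ψ x ^ 2) + b * (∫ x in L1..L2, vx x ^ 2)) := by
    have h1 := hsq φ hL1.le
    have h2 := hsq φ hL23.le
    have h3 := hsq ux hL1.le
    have h4 := hsq ux hL23.le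
    have h5 := hsq ψ hL12.le
    have h6 := hsq vx hL12.le
    positivity
  have hκ : Real.sqrt (1 + δ ^ 2) / (2 * τ) * (ξb * m1 * τ)
      = ξb * m1 * (Real.sqrt (1 + δ ^ 2) / 2) := by
    field_simp
  rw [mul_add (Real.sqrt (1 + δ ^ 2) / (2 * τ)), ← mul_assoc _ (ξb * m1 * τ), hκ, hJ]
  linarith
end
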